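/- Suppose W, Z ⊆ ℕ satisfy W ≰_T Z, and f : [ℕ]^2 → ℕ is a 2-bounded coloring such that ℕ itself is a tail f-rainbow (with no computability hypothesis on f). Then there exists an infinite f-rainbow G such that W ≰_T G ⊕ Z. -/

import Mathlib

namespace RRT

/-- Partial functions on ℕ that are recursive in the oracle `O`.
This mirrors `Nat.Partrec`, with an extra constructor for the oracle. -/
inductive RecursiveIn (O : ℕ →. ℕ) : (ℕ →. ℕ) → Prop
  | zero : RecursiveIn O (pure 0)
  | succ : RecursiveIn O Nat.succ
  | left : RecursiveIn O ↑fun n : ℕ => n.unpair.1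
  | right : RecursiveIn O ↑fun n : ℕ => n.unpair.2
  | oracle : RecursiveIn O O
  | pair {f g} : RecursiveIn O f → RecursiveIn O g →
      RecursiveIn O fun n => Nat.pair <$> f n <*> g n
  | comp {f g} : RecursiveIn O f → RecursiveIn O g →
      RecursiveIn O fun n => g n >>= f
  | prec {f g} : RecursiveIn O f → RecursiveIn O g →
      RecursiveIn O (Nat.unpaired fun a n =>
        n.rec (f a) fun y IH => do let i ← IH; g (Nat.pair a (Nat.pair y i)))
  | rfind {f} : RecursiveIn O f →
      RecursiveIn O fun a => Nat.rfind fun n => (fun m => m = 0) <$> f (Nat.pair a n)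

/-- The characteristic function of a set of naturals. -/
noncomputable def chi (A : Set ℕ) : ℕ → ℕ := A.indicator fun _ => 1

/-- Turing reducibility `A ≤_T B` for sets of naturals: the characteristic function of `A`
is computable relative to an oracle for the characteristic function of `B`. -/
def TuringLE (A B : Set ℕ) : Prop := RecursiveIn (chi B) (chi A)

/-- The recursive join `A ⊕ B = {2n : n ∈ A} ∪ {2n+1 : n ∈ B}`. -/
def join (A B : Set ℕ) : Set ℕ :=
  {n : ℕ | (∃ m ∈ A, n = 2 * m) ∨ (∃ m ∈ B, n = 2 * m + 1)}

/-- A total function `f : ℕ → ℕ` is computable relative to an oracle for `Z ⊆ ℕ`. -/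
def FunRecIn (Z : Set ℕ) (f : ℕ → ℕ) : Prop := RecursiveIn (chi Z) f


/-- A coloring of `[ℕ]²` (identified with pairs `(x,y)`, `x < y`) is 2-bounded if
every color has at most 2 preimages. -/
def Bounded2Pairs (f : ℕ → ℕ → ℕ) : Prop :=
  ∀ c : ℕ, {p : ℕ × ℕ | p.1 < p.2 ∧ f p.1 p.2 = c}.encard ≤ 2

/-- `X` is an `f`-rainbow: `f` is injective on `[X]²`. -/
def RainbowOn (f : ℕ → ℕ → ℕ) (X : Set ℕ) : Prop :=
  ∀ x₀ x₁ y₀ y₁ : ℕ, x₀ ∈ X → x₁ ∈ X → y₀ ∈ X → y₁ ∈ X →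
    x₀ < x₁ → y₀ < y₁ → f x₀ x₁ = f y₀ y₁ → x₀ = y₀ ∧ x₁ = y₁

/-- `X` is a tail `f`-rainbow: pairs from `X` with distinct second coordinates get
distinct colors. -/
def TailRainbowOn (f : ℕ → ℕ → ℕ) (X : Set ℕ) : Prop :=
  ∀ x₀ x₁ y₀ y₁ : ℕ, x₀ ∈ X → x₁ ∈ X → y₀ ∈ X → y₁ ∈ X →
    x₀ < x₁ → y₀ < y₁ → x₁ ≠ y₁ → f x₀ x₁ ≠ f y₀ y₁


/-- The length-`k` initial segment of `Y`. -/
def pre (Y : ℕ → Bool) (k : ℕ) : List Bool := (List.range k).map Y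

theorem pre_length (Y : ℕ → Bool) (k : ℕ) : (pre Y k).length = k := by simp [pre]

theorem pre_get (Y : ℕ → Bool) (k i : ℕ) :
    (pre Y k)[i]? = if i < k then some (Y i) else none := by
  by_cases h : i < k <;> simp [pre, h]

theorem pre_congr {Y Y' : ℕ → Bool} {k : ℕ} (h : ∀ i < k, Y i = Y' i) : pre Y k = pre Y' k := by
  unfold pre
  apply List.map_congr_left
  intro i hi
  exact h i (List.mem_range.1 hi)

theorem pre_getD (Y : ℕ → Bool) (k i : ℕ) (h : i < k) : (pre Y k).getD i false = Y i := by
  simp [List.getD, pre_get, h]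

theorem eq_pre {Y : ℕ → Bool} {τ : List Bool} (h : ∀ i < τ.length, Y i = τ.getD i false) :
    τ = pre Y τ.length := by
  apply List.ext_getElem?
  intro i
  rw [pre_get]
  by_cases hi : i < τ.length
  · simp [hi, h i hi]
  · simp [hi]

/-- `p` is (uniformly) recursively enumerable relative to the oracle `o ω`. -/
def SgO {α Ω : Type} [Primcodable α] (o : Ω → ℕ → Bool) (p : α → Ω → Prop) : Prop :=
  ∃ R : α → List Bool → Prop, PrimrecRel R ∧
    (∀ a Y k k', k ≤ k' → R a (pre Y k) → R a (pre Y k')) ∧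
    ∀ a ω, p a ω ↔ ∃ k, R a (pre (o ω) k)

section closure
variable {α β Ω : Type} [Primcodable α] [Primcodable β] {o : Ω → ℕ → Bool}

theorem SgO.of_iff {p q : α → Ω → Prop} (h : SgO o p) (e : ∀ a ω, q a ω ↔ p a ω) : SgO o q := by
  obtain ⟨R, h1, h2, h3⟩ := h
  exact ⟨R, h1, h2, fun a ω => (e a ω).trans (h3 a ω)⟩

theorem SgO.prim {p : α → Prop} (h : PrimrecPred p) : SgO o (fun a (_ : Ω) => p a) :=
  ⟨fun a _ => p a, h.comp Primrec.fst, fun _ _ _ _ _ h => h, fun a ω => by simp⟩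

theorem SgO.read {t : α → ℕ} {b : α → Bool} (ht : Primrec t) (hb : Primrec b) :
    SgO o (fun a ω => o ω (t a) = b a) := by
  refine ⟨fun a σ => σ[t a]? = some (b a), ?_, ?_, ?_⟩
  · exact Primrec.eq.comp (Primrec.list_getElem?.comp Primrec.snd (ht.comp Primrec.fst))
      (Primrec.option_some.comp (hb.comp Primrec.fst))
  · intro a Y k k' hk
    simp only [pre_get]
    split_ifs with h1 h2 <;> simp
    omega
  · intro a ω
    simp only [pre_get]
    constructor
    · intro h
      exact ⟨t a + 1, by simp [h]⟩
    · rintro ⟨k, h⟩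
      split_ifs at h
      simpa using h

theorem SgO.comp {p : β → Ω → Prop} (h : SgO o p) {t : α → β} (ht : Primrec t) :
    SgO o (fun a ω => p (t a) ω) := by
  obtain ⟨R, h1, h2, h3⟩ := h
  exact ⟨fun a σ => R (t a) σ, h1.comp (ht.comp Primrec.fst) Primrec.snd,
    fun a => h2 (t a), fun a => h3 (t a)⟩

theorem SgO.and {p q : α → Ω → Prop} (hp : SgO o p) (hq : SgO o q) :
    SgO o (fun a ω => p a ω ∧ q a ω) := by
  obtain ⟨R, h1, h2, h3⟩ := hp
  obtain ⟨S, g1, g2, g3⟩ := hq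
  refine ⟨fun a σ => R a σ ∧ S a σ, PrimrecPred.and h1 g1,
    fun a Y k k' hk h => ⟨h2 _ _ _ _ hk h.1, g2 _ _ _ _ hk h.2⟩, ?_⟩
  intro a ω
  show p a ω ∧ q a ω ↔ _
  rw [h3, g3]
  constructor
  · rintro ⟨⟨k, hk⟩, ⟨l, hl⟩⟩
    exact ⟨max k l, h2 _ _ _ _ (le_max_left _ _) hk, g2 _ _ _ _ (le_max_right _ _) hl⟩
  · rintro ⟨k, h, h'⟩
    exact ⟨⟨k, h⟩, ⟨k, h'⟩⟩

theorem SgO.or {p q : α → Ω → Prop} (hp : SgO o p) (hq : SgO o q) :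
    SgO o (fun a ω => p a ω ∨ q a ω) := by
  obtain ⟨R, h1, h2, h3⟩ := hp
  obtain ⟨S, g1, g2, g3⟩ := hq
  refine ⟨fun a σ => R a σ ∨ S a σ, PrimrecPred.or h1 g1,
    fun a Y k k' hk h => h.imp (h2 _ _ _ _ hk) (g2 _ _ _ _ hk), ?_⟩
  intro a ω
  show p a ω ∨ q a ω ↔ _
  rw [h3, g3, exists_or]

theorem SgO.ex {p : α → β → Ω → Prop} (h : SgO o (fun (x : α × β) ω => p x.1 x.2 ω)) :
    SgO o (fun a ω => ∃ b, p a b ω) := by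
  classical
  obtain ⟨R, h1, h2, h3⟩ := h
  let Q : ℕ → α × List Bool → Prop := fun m y =>
    (Option.casesOn (Encodable.decode (α := β) m) false (fun b => decide (R (y.1, b) y.2)) : Bool)
      = true
  have hQ : PrimrecRel Q := by
    refine PrimrecRel.comp (R := @Eq Bool) Primrec.eq ?_ (Primrec.const true)
    refine Primrec.option_casesOn (Primrec.decode.comp Primrec.fst) (Primrec.const false) ?_
    have := h1.decide
    exact this.comp (Primrec.pair (Primrec.fst.comp (Primrec.snd.comp Primrec.fst)) Primrec.snd)
      (Primrec.snd.comp (Primrec.snd.comp Primrec.fst))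
  have hQi : ∀ m a σ, Q m (a, σ) ↔ ∃ b, Encodable.decode (α := β) m = some b ∧ R (a, b) σ := by
    intro m a σ
    simp only [Q]
    cases Encodable.decode (α := β) m <;> simp
  refine ⟨fun a σ => ∃ m < σ.length, Q m (a, σ), ?_, ?_, ?_⟩
  · refine PrimrecPred.of_eq (hQ.exists_mem_list.comp
      (Primrec.list_range.comp (Primrec.list_length.comp Primrec.snd)) Primrec.id) ?_
    simp
  · simp only [hQi, pre_length]
    rintro a Y k k' hk ⟨m, hm, b, hb, hR⟩
    exact ⟨m, by omega, b, hb, h2 _ _ _ _ hk hR⟩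
  · intro a ω
    simp only [hQi, pre_length]
    constructor
    · rintro ⟨b, hb⟩
      obtain ⟨k, hk⟩ := (h3 (a, b) ω).1 hb
      exact ⟨max k (Encodable.encode b + 1), Encodable.encode b, by simp, b,
        Encodable.encodek b, h2 _ _ _ _ (le_max_left _ _) hk⟩
    · rintro ⟨k, m, _, b, _, hR⟩
      exact ⟨b, (h3 (a, b) ω).2 ⟨k, hR⟩⟩

theorem SgO.ball {p : α → ℕ → Ω → Prop} {t : α → ℕ} (ht : Primrec t)
    (h : SgO o (fun (x : α × ℕ) ω => p x.1 x.2 ω)) :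
    SgO o (fun a ω => ∀ i < t a, p a i ω) := by
  obtain ⟨R, h1, h2, h3⟩ := h
  let Q : ℕ → α × List Bool → Prop := fun m y => R (y.1, m) y.2
  have hQ : PrimrecRel Q :=
    h1.comp (Primrec.pair (Primrec.fst.comp Primrec.snd) Primrec.fst)
      (Primrec.snd.comp Primrec.snd)
  refine ⟨fun a σ => ∀ m < t a, Q m (a, σ), ?_, ?_, ?_⟩
  · refine PrimrecPred.of_eq (hQ.forall_mem_list.comp
      (Primrec.list_range.comp (ht.comp Primrec.fst)) Primrec.id) ?_
    simp
  · intro a Y k k' hk h m hm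
    exact h2 _ _ _ _ hk (h m hm)
  · intro a ω
    constructor
    · intro h
      have h' : ∀ i, ∃ k, i < t a → R (a, i) (pre (o ω) k) := by
        intro i
        by_cases hi : i < t a
        · obtain ⟨k, hk⟩ := (h3 (a, i) ω).1 (h i hi)
          exact ⟨k, fun _ => hk⟩
        · exact ⟨0, fun h => absurd h hi⟩
      choose k hk using h'
      refine ⟨(Finset.range (t a)).sup k, fun m hm => ?_⟩
      exact h2 _ _ _ _ (Finset.le_sup (f := k) (Finset.mem_range.2 hm)) (hk m hm)
    · rintro ⟨k, hk⟩ i hi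
      exact (h3 (a, i) ω).2 ⟨k, hk i hi⟩

theorem SgO.bex {p : α → ℕ → Ω → Prop} {t : α → ℕ} (ht : Primrec t)
    (h : SgO o (fun (x : α × ℕ) ω => p x.1 x.2 ω)) :
    SgO o (fun a ω => ∃ i < t a, p a i ω) := by
  apply SgO.ex
  apply SgO.and _ h
  exact SgO.prim (Primrec.nat_lt.comp Primrec.snd (ht.comp Primrec.fst))

theorem SgO.subst {Ω' : Type} {o' : Ω' → ℕ → Bool} {r : α → Ω' → Prop} (hr : SgO o' r)
    (w : α → Ω → Ω')
    (hD : SgO o (fun (x : α × ℕ × Bool) ω => o' (w x.1 ω) x.2.1 = x.2.2)) :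
    SgO o (fun a ω => r a (w a ω)) := by
  obtain ⟨R, h1, h2, h3⟩ := hr
  have key : SgO o (fun a ω => ∃ τ : List Bool, R a τ ∧
      ∀ i < τ.length, o' (w a ω) i = τ.getD i false) := by
    apply SgO.ex
    apply SgO.and
    · exact SgO.prim (h1.comp Primrec.fst Primrec.snd)
    · apply SgO.ball (Primrec.list_length.comp Primrec.snd)
      exact hD.comp (Primrec.pair (Primrec.fst.comp Primrec.fst)
        (Primrec.pair Primrec.snd ((Primrec.list_getD false).comp
          (Primrec.snd.comp Primrec.fst) Primrec.snd)))
  refine key.of_iff fun a ω => ?_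
  rw [h3]
  constructor
  · rintro ⟨k, hk⟩
    refine ⟨_, hk, fun i hi => ?_⟩
    rw [pre_length] at hi
    rw [pre_getD _ _ _ hi]
  · rintro ⟨τ, hR, hτ⟩
    refine ⟨τ.length, ?_⟩
    rwa [← eq_pre hτ]

/-- finite use -/
theorem SgO.use {p : α → Ω → Prop} (h : SgO o p) {a : α} {ω : Ω} (hp : p a ω) :
    ∃ u, ∀ ω', (∀ i < u, o ω i = o ω' i) → p a ω' := by
  obtain ⟨R, h1, h2, h3⟩ := h
  obtain ⟨k, hk⟩ := (h3 _ _).1 hp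
  refine ⟨k, fun ω' h => (h3 _ _).2 ⟨k, ?_⟩⟩
  rwa [← pre_congr h]

end closure

/-- The join of two oracles. -/
def jn (X Y : ℕ → Bool) (n : ℕ) : Bool := if n % 2 = 0 then X (n / 2) else Y (n / 2)

theorem jn_even (X Y : ℕ → Bool) (n : ℕ) : jn X Y (2 * n) = X n := by
  simp [jn]

theorem jn_odd (X Y : ℕ → Bool) (n : ℕ) : jn X Y (2 * n + 1) = Y n := by
  have : (2 * n + 1) / 2 = n := by omega
  simp [jn, this]

theorem isOpen_of_use {S : Set (ℕ → Bool)}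
    (h : ∀ Y ∈ S, ∃ u, ∀ Y', (∀ i < u, Y i = Y' i) → Y' ∈ S) : IsOpen S := by
  rw [isOpen_pi_iff]
  intro Y hY
  obtain ⟨u, hu⟩ := h Y hY
  refine ⟨Finset.range u, fun i => {Y i}, fun i _ => ⟨isOpen_discrete _, rfl⟩, fun Y' hY' => ?_⟩
  exact hu Y' fun i hi => (hY' i (by simpa using hi)).symm

section closure2
variable {α Ω : Type} [Primcodable α] {o : Ω → ℕ → Bool}

theorem SgO.jn_iff {X Y : α → Ω → ℕ → Bool} {t : α → ℕ} {b : α → Bool} (ht : Primrec t)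
    (hX : SgO o (fun a ω => X a ω (t a / 2) = b a)) (hY : SgO o (fun a ω => Y a ω (t a / 2) = b a)) :
    SgO o (fun a ω => jn (X a ω) (Y a ω) (t a) = b a) := by
  have e : Primrec fun a => t a % 2 := Primrec.nat_mod.comp ht (Primrec.const 2)
  have h0 : PrimrecPred fun a => t a % 2 = 0 := Primrec.eq.comp e (Primrec.const 0)
  refine (((SgO.prim (o := o) h0).and hX).or ((SgO.prim (o := o) h0.not).and hY)).of_iff ?_
  intro a ω
  by_cases h : t a % 2 = 0 <;> simp [jn, h]

theorem primrec_testBit : Primrec₂ Nat.testBit := by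
  have h2 : Primrec₂ (fun a b : ℕ => a ^ b) := Primrec₂.unpaired'.1 Nat.Primrec.pow
  have : PrimrecRel (fun t i : ℕ => t / 2 ^ i % 2 = 1) :=
    Primrec.eq.comp (Primrec.nat_mod.comp (Primrec.nat_div.comp Primrec.fst
      (h2.comp (Primrec.const 2) Primrec.snd)) (Primrec.const 2)) (Primrec.const 1)
  exact this.decide.of_eq fun a b => by rw [Nat.testBit_eq_decide_div_mod_eq]

theorem SgO.all_cantor {B : ℕ → Bool} {p : α → (ℕ → Bool) → Prop} (hp : SgO (jn B) p) :
    SgO (fun _ : Unit => B) (fun a _ => ∀ Y, p a Y) := by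
  obtain ⟨R, h1, h2, h3⟩ := hp
  have h2' : Primrec₂ (fun a b : ℕ => a ^ b) := Primrec₂.unpaired'.1 Nat.Primrec.pow
  have key : SgO (fun _ : Unit => B) (fun a _ => ∃ k : ℕ, ∀ t < 2 ^ k, ∃ σ : List Bool,
      σ.length = k ∧ R a σ ∧ ∀ i < k, jn B (Nat.testBit t) i = σ.getD i false) := by
    apply SgO.ex
    apply SgO.ball (h2'.comp (Primrec.const 2) Primrec.snd)
    apply SgO.ex
    apply SgO.and
    · exact SgO.prim (Primrec.eq.comp (Primrec.list_length.comp Primrec.snd)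
        (Primrec.snd.comp (Primrec.fst.comp Primrec.fst)))
    apply SgO.and
    · exact SgO.prim (h1.comp (Primrec.fst.comp (Primrec.fst.comp Primrec.fst)) Primrec.snd)
    · apply SgO.ball (Primrec.snd.comp (Primrec.fst.comp Primrec.fst))
      have hb : Primrec (fun x : (((α × ℕ) × ℕ) × List Bool) × ℕ => x.1.2.getD x.2 false) :=
        (Primrec.list_getD false).comp (Primrec.snd.comp Primrec.fst) Primrec.snd
      have hd : Primrec (fun x : (((α × ℕ) × ℕ) × List Bool) × ℕ => x.2 / 2) :=
        Primrec.nat_div.comp Primrec.snd (Primrec.const 2)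
      refine SgO.jn_iff (X := fun _ _ => B) (Y := fun (x : (((α × ℕ) × ℕ) × List Bool) × ℕ) _ => Nat.testBit x.1.1.2)
        Primrec.snd ?_ ?_
      · exact SgO.read (o := fun _ : Unit => B) hd hb
      · exact SgO.prim (Primrec.eq.comp (primrec_testBit.comp
          (Primrec.snd.comp (Primrec.fst.comp Primrec.fst)) hd) hb)
  refine key.of_iff fun a _ => ?_
  simp only [h3]
  constructor
  · intro H
    by_contra hcon
    push Not at hcon
    let C : ℕ → Set (ℕ → Bool) := fun k => {Y | ¬ R a (pre (jn B Y) k)}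
    have hcl : ∀ k, IsClosed (C k) := by
      intro k
      rw [← isOpen_compl_iff]
      apply isOpen_of_use
      intro Y hY
      refine ⟨k, fun Y' h => ?_⟩
      have : pre (jn B Y) k = pre (jn B Y') k := by
        apply pre_congr
        intro i hi
        unfold jn
        rw [h (i / 2) (by omega)]
      simpa [C, ← this] using hY
    have hC : (⋂ k, C k).Nonempty := by
      apply IsCompact.nonempty_iInter_of_sequence_nonempty_isCompact_isClosed
      · intro k Y hY hR
        exact hY (h2 _ _ _ _ (Nat.le_succ k) hR)
      · intro k
        obtain ⟨t, ht, hc⟩ := hcon k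
        refine ⟨Nat.testBit t, fun hR => ?_⟩
        obtain ⟨i, hi, hne⟩ := hc _ (pre_length _ _) hR
        exact hne (pre_getD _ _ _ hi).symm
      · exact (hcl 0).isCompact
      · exact hcl
    obtain ⟨Y, hY⟩ := hC
    obtain ⟨k, hk⟩ := H Y
    exact (Set.mem_iInter.1 hY k) hk
  · rintro ⟨k, hk⟩ Y
    refine ⟨k, ?_⟩
    let t := Nat.ofBits (fun i : Fin k => Y i)
    obtain ⟨σ, hl, hR, hσ⟩ := hk t (Nat.ofBits_lt_two_pow _)
    have : σ = pre (jn B Y) k := by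
      rw [← hl]
      apply eq_pre
      intro i hi
      rw [hl] at hi
      rw [← hσ i hi]
      unfold jn
      split_ifs
      · rfl
      · have : i / 2 < k := by omega
        simp [t, Nat.testBit_ofBits_lt _ _ this]
    rwa [← this]

end closure2

/-- Boolean characteristic function. -/
noncomputable def cb (A : Set ℕ) : ℕ → Bool := fun n => by classical exact decide (n ∈ A)

theorem cb_true {A : Set ℕ} {n : ℕ} : cb A n = true ↔ n ∈ A := by simp [cb]

/-- Turing reducibility for Boolean-valued functions, through enumerations. -/
def Le (A B : ℕ → Bool) : Prop :=
  SgO (fun _ : Unit => B) (fun (x : ℕ × Bool) _ => A x.1 = x.2)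

theorem sg_of_recursiveIn {A : Set ℕ} {φ : ℕ →. ℕ} (h : RecursiveIn (chi A) φ) :
    SgO (fun _ : Unit => cb A) (fun (x : ℕ × ℕ) _ => x.2 ∈ φ x.1) := by
  induction h with
  | zero =>
    refine (SgO.prim (p := fun x : ℕ × ℕ => x.2 = 0)
      (Primrec.eq.comp Primrec.snd (Primrec.const 0))).of_iff fun x _ => ?_
    simp [pure, PFun.pure, Part.mem_some_iff]
  | succ =>
    refine (SgO.prim (p := fun x : ℕ × ℕ => x.2 = Nat.succ x.1)
      (Primrec.eq.comp Primrec.snd (Primrec.succ.comp Primrec.fst))).of_iff fun x _ => ?_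
    simp
  | left =>
    refine (SgO.prim (p := fun x : ℕ × ℕ => x.2 = x.1.unpair.1)
      (Primrec.eq.comp Primrec.snd (Primrec.fst.comp (Primrec.unpair.comp Primrec.fst)))).of_iff
      fun x _ => ?_
    simp
  | right =>
    refine (SgO.prim (p := fun x : ℕ × ℕ => x.2 = x.1.unpair.2)
      (Primrec.eq.comp Primrec.snd (Primrec.snd.comp (Primrec.unpair.comp Primrec.fst)))).of_iff
      fun x _ => ?_
    simp
  | oracle =>
    have h1 : SgO (fun _ : Unit => cb A) (fun (x : ℕ × ℕ) _ => cb A x.1 = true) :=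
      SgO.read Primrec.fst (Primrec.const true)
    have h2 : SgO (fun _ : Unit => cb A) (fun (x : ℕ × ℕ) _ => cb A x.1 = false) :=
      SgO.read Primrec.fst (Primrec.const false)
    refine ((h1.and (SgO.prim (p := fun x : ℕ × ℕ => x.2 = 1)
      (Primrec.eq.comp Primrec.snd (Primrec.const 1)))).or
      (h2.and (SgO.prim (p := fun x : ℕ × ℕ => x.2 = 0)
      (Primrec.eq.comp Primrec.snd (Primrec.const 0))))).of_iff fun x _ => ?_
    by_cases hx : x.1 ∈ A <;> simp [cb, chi, hx]
  | @pair f g _ _ hf hg =>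
    have : SgO (fun _ : Unit => cb A) (fun (x : ℕ × ℕ) _ => ∃ y : ℕ × ℕ,
        x.2 = Nat.pair y.1 y.2 ∧ y.1 ∈ f x.1 ∧ y.2 ∈ g x.1) := by
      apply SgO.ex
      apply SgO.and
      · exact SgO.prim (Primrec.eq.comp (Primrec.snd.comp Primrec.fst)
          (Primrec₂.natPair.comp (Primrec.fst.comp Primrec.snd) (Primrec.snd.comp Primrec.snd)))
      apply SgO.and
      · exact hf.comp (Primrec.pair (Primrec.fst.comp Primrec.fst) (Primrec.fst.comp Primrec.snd))
      · exact hg.comp (Primrec.pair (Primrec.fst.comp Primrec.fst) (Primrec.snd.comp Primrec.snd))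
    refine this.of_iff fun x _ => ?_
    simp only [Seq.seq, Part.map_eq_map, Part.bind_map, Part.mem_bind_iff, Part.mem_map_iff,
      Prod.exists]
    constructor
    · rintro ⟨a, ha, b, hb, h⟩
      exact ⟨a, b, h.symm, ha, hb⟩
    · rintro ⟨a, b, h, ha, hb⟩
      exact ⟨a, ha, b, hb, h.symm⟩
  | @comp f g _ _ hf hg =>
    have : SgO (fun _ : Unit => cb A) (fun (x : ℕ × ℕ) _ => ∃ y : ℕ, y ∈ g x.1 ∧ x.2 ∈ f y) := by
      apply SgO.ex
      apply SgO.and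
      · exact hg.comp (Primrec.pair (Primrec.fst.comp Primrec.fst) Primrec.snd)
      · exact hf.comp (Primrec.pair Primrec.snd (Primrec.snd.comp Primrec.fst))
    refine this.of_iff fun x _ => ?_
    exact Part.mem_bind_iff
  | @prec f g _ _ hf hg =>
    have : SgO (fun _ : Unit => cb A) (fun (x : ℕ × ℕ) _ => ∃ l : List ℕ,
        l.getD 0 0 ∈ f x.1.unpair.1 ∧ x.2 = l.getD x.1.unpair.2 0 ∧
        ∀ y < x.1.unpair.2, l.getD (y + 1) 0 ∈
          g (Nat.pair x.1.unpair.1 (Nat.pair y (l.getD y 0)))) := by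
      apply SgO.ex
      apply SgO.and
      · exact hf.comp (Primrec.pair
          (Primrec.fst.comp (Primrec.unpair.comp (Primrec.fst.comp Primrec.fst)))
          ((Primrec.list_getD 0).comp Primrec.snd (Primrec.const 0)))
      apply SgO.and
      · exact SgO.prim (Primrec.eq.comp (Primrec.snd.comp Primrec.fst)
          ((Primrec.list_getD 0).comp Primrec.snd
            (Primrec.snd.comp (Primrec.unpair.comp (Primrec.fst.comp Primrec.fst)))))
      · apply SgO.ball (Primrec.snd.comp (Primrec.unpair.comp (Primrec.fst.comp Primrec.fst)))
        exact hg.comp (Primrec.pair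
          (Primrec₂.natPair.comp
            (Primrec.fst.comp (Primrec.unpair.comp
              (Primrec.fst.comp (Primrec.fst.comp Primrec.fst))))
            (Primrec₂.natPair.comp Primrec.snd
              ((Primrec.list_getD 0).comp (Primrec.snd.comp Primrec.fst) Primrec.snd)))
          ((Primrec.list_getD 0).comp (Primrec.snd.comp Primrec.fst)
            (Primrec.succ.comp Primrec.snd)))
    refine this.of_iff fun x _ => ?_
    obtain ⟨x, v⟩ := x
    simp only [Nat.unpaired]
    generalize x.unpair.1 = a
    generalize x.unpair.2 = n
    induction n generalizing v with
    | zero =>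
      simp only [Nat.not_lt_zero, false_implies, implies_true, and_true]
      constructor
      · intro h
        exact ⟨[v], h, rfl⟩
      · rintro ⟨l, h, rfl⟩
        exact h
    | succ n ih =>
      simp only [Part.bind_eq_bind, Part.mem_bind_iff]
      constructor
      · rintro ⟨i, hi, hv⟩
        obtain ⟨l, h0, h1, h2⟩ := (ih i).1 hi
        refine ⟨(List.range (n + 1)).map (fun i => l.getD i 0) ++ [v], ?_⟩
        have e1 : ∀ i ≤ n, ((List.range (n + 1)).map (fun i => l.getD i 0) ++ [v]).getD i 0
            = l.getD i 0 := by
          intro i hi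
          rw [List.getD_append _ _ _ _ (by simp; omega)]
          simp [List.getD, Nat.lt_succ_of_le hi]
        have e2 : ((List.range (n + 1)).map (fun i => l.getD i 0) ++ [v]).getD (n + 1) 0 = v := by
          rw [List.getD_append_right _ _ _ _ (by simp)]
          simp
        refine ⟨by rw [e1 0 (by omega)]; exact h0, e2.symm, fun y hy => ?_⟩
        rcases Nat.lt_succ_iff_lt_or_eq.1 hy with hy | rfl
        · rw [e1 _ (by omega), e1 _ (by omega)]
          exact h2 y hy
        · rw [e2, e1 _ le_rfl, ← h1]
          exact hv
      · rintro ⟨l, h0, rfl, h2⟩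
        exact ⟨l.getD n 0, (ih _).2 ⟨l, h0, rfl, fun y hy => h2 y (by omega)⟩, h2 n (by omega)⟩
  | @rfind f _ hf =>
    have : SgO (fun _ : Unit => cb A) (fun (x : ℕ × ℕ) _ => 0 ∈ f (Nat.pair x.1 x.2) ∧
        ∀ k < x.2, ∃ m, m ≠ 0 ∧ m ∈ f (Nat.pair x.1 k)) := by
      apply SgO.and
      · exact hf.comp (Primrec.pair (Primrec₂.natPair.comp Primrec.fst Primrec.snd)
          (Primrec.const 0))
      · apply SgO.ball Primrec.snd
        apply SgO.ex
        apply SgO.and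
        · exact SgO.prim (PrimrecPred.not (Primrec.eq.comp Primrec.snd (Primrec.const 0)))
        · exact hf.comp (Primrec.pair (Primrec₂.natPair.comp
            (Primrec.fst.comp (Primrec.fst.comp Primrec.fst))
            (Primrec.snd.comp Primrec.fst)) Primrec.snd)
    refine this.of_iff fun x _ => ?_
    refine Nat.mem_rfind.trans ?_
    simp only [Part.map_eq_map, Part.mem_map_iff]
    constructor
    · rintro ⟨⟨m, h, h'⟩, h2⟩
      have : m = 0 := by simpa using h'
      subst this
      refine ⟨h, fun k hk => ?_⟩
      obtain ⟨m, hm, hm'⟩ := h2 hk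
      exact ⟨m, by simpa using hm', hm⟩
    · rintro ⟨h, h2⟩
      refine ⟨⟨0, h, by simp⟩, fun {k} hk => ?_⟩
      obtain ⟨m, hm, hm'⟩ := h2 k hk
      exact ⟨m, hm', by simpa using hm⟩

theorem rec_of_partrec {O : ℕ →. ℕ} {f : ℕ →. ℕ} (h : Nat.Partrec f) : RecursiveIn O f := by
  induction h with
  | zero => exact .zero
  | succ => exact .succ
  | left => exact .left
  | right => exact .right
  | pair _ _ h1 h2 => exact .pair h1 h2
  | comp _ _ h1 h2 => exact .comp h1 h2
  | prec _ _ h1 h2 => exact .prec h1 h2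
  | rfind _ h1 => exact .rfind h1

theorem rec_of_prim {O : ℕ →. ℕ} {f : ℕ → ℕ} (h : Primrec f) : RecursiveIn O (f : ℕ →. ℕ) :=
  rec_of_partrec (Nat.Partrec.of_primrec (Primrec.nat_iff.1 h))

theorem rec_of_eq {O f g : ℕ →. ℕ} (h : RecursiveIn O f) (e : ∀ n, g n = f n) :
    RecursiveIn O g := by
  have : g = f := funext e
  rw [this]
  exact h

theorem rec_comp {O : ℕ →. ℕ} {f g : ℕ → ℕ} (hf : RecursiveIn O (f : ℕ →. ℕ))
    (hg : RecursiveIn O (g : ℕ →. ℕ)) : RecursiveIn O ((fun n => f (g n) : ℕ → ℕ) : ℕ →. ℕ) := by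
  have := RecursiveIn.comp hf hg
  refine rec_of_eq this fun n => ?_
  exact (Part.bind_some _ _).symm

theorem rec_pair {O : ℕ →. ℕ} {f g : ℕ → ℕ} (hf : RecursiveIn O (f : ℕ →. ℕ))
    (hg : RecursiveIn O (g : ℕ →. ℕ)) :
    RecursiveIn O ((fun n => Nat.pair (f n) (g n) : ℕ → ℕ) : ℕ →. ℕ) := by
  have := RecursiveIn.pair hf hg
  refine rec_of_eq this fun n => ?_
  simp [Seq.seq]

theorem rec_pre (A : Set ℕ) :
    RecursiveIn (chi A) ((fun k => Encodable.encode (pre (cb A) k) : ℕ → ℕ) : ℕ →. ℕ) := by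
  let s : ℕ → ℕ := fun x =>
    Encodable.encode (((Encodable.decode (α := List Bool) x.unpair.1).getD []) ++
      [decide (x.unpair.2 = 1)])
  have hs : Primrec s := by
    refine Primrec.encode.comp (Primrec.list_concat.comp (Primrec.option_getD.comp
      (Primrec.decode.comp (Primrec.fst.comp Primrec.unpair)) (Primrec.const [])) ?_)
    exact PrimrecPred.decide (Primrec.eq.comp (Primrec.snd.comp Primrec.unpair) (Primrec.const 1))
  have hr : Primrec (fun x : ℕ => x.unpair.2) := Primrec.snd.comp Primrec.unpair
  have hl : Primrec (fun x : ℕ => x.unpair.1) := Primrec.fst.comp Primrec.unpair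
  have hO : RecursiveIn (chi A) ((chi A : ℕ → ℕ) : ℕ →. ℕ) := .oracle
  have hg := rec_comp (rec_of_prim (O := chi A) hs)
    (rec_pair (rec_of_prim (O := chi A) (hr.comp hr))
      (rec_comp hO (rec_of_prim (O := chi A) (hl.comp hr))))
  have hf := rec_of_prim (O := chi A)
    (Primrec.const (α := ℕ) (Encodable.encode ([] : List Bool)))
  have hp := RecursiveIn.comp (RecursiveIn.prec hf hg)
    (rec_of_prim (O := chi A) (Primrec₂.natPair.comp (Primrec.const 0) Primrec.id))
  refine rec_of_eq hp fun k => ?_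
  simp only [PFun.coe_val, Part.bind_eq_bind, Part.bind_some, Nat.unpaired, Nat.unpair_pair, id]
  induction k with
  | zero => simp [pre]
  | succ k ih =>
    simp only [← ih, Part.bind_some]
    congr 1
    simp only [s, Nat.unpair_pair, Encodable.encodek, Option.getD_some]
    congr 1
    unfold pre
    rw [List.range_succ, List.map_append]
    by_cases h : k ∈ A <;> simp [cb, chi, h]

theorem recursiveIn_of_Le {W A : Set ℕ} (h : Le (cb W) (cb A)) : TuringLE W A := by
  classical
  obtain ⟨R, h1, h2, h3⟩ := h
  have hd := h1.decide
  let dl : ℕ → List Bool := fun x => (Encodable.decode (α := List Bool) x).getD []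
  have hdl : Primrec dl := Primrec.option_getD.comp Primrec.decode (Primrec.const [])
  have hr : Primrec (fun x : ℕ => x.unpair.2) := Primrec.snd.comp Primrec.unpair
  have hl : Primrec (fun x : ℕ => x.unpair.1) := Primrec.fst.comp Primrec.unpair
  let T : ℕ → ℕ := fun x =>
    if R (x.unpair.1, true) (dl x.unpair.2) ∨ R (x.unpair.1, false) (dl x.unpair.2) then 0 else 1
  have hRb : ∀ b, PrimrecPred (fun x : ℕ => R (x.unpair.1, b) (dl x.unpair.2)) := fun b =>
    h1.comp (Primrec.pair hl (Primrec.const b)) (hdl.comp hr)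
  have hT : Primrec T :=
    Primrec.ite ((hRb true).or (hRb false)) (Primrec.const 0) (Primrec.const 1)
  let U : ℕ → ℕ := fun x => if R (x.unpair.1, true) (dl x.unpair.2) then 1 else 0
  have hU : Primrec U := Primrec.ite (hRb true) (Primrec.const 1) (Primrec.const 0)
  have hpre := rec_pre A
  have hT' := rec_comp (rec_of_prim (O := chi A) hT) (rec_pair (rec_of_prim (O := chi A) hl)
    (rec_comp hpre (rec_of_prim (O := chi A) hr)))
  have hU' := rec_comp (rec_of_prim (O := chi A) hU) (rec_pair (rec_of_prim (O := chi A) hl)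
    (rec_comp hpre (rec_of_prim (O := chi A) hr)))
  have hk := RecursiveIn.rfind hT'
  have hid : RecursiveIn (chi A) ((fun n => n : ℕ → ℕ) : ℕ →. ℕ) :=
    rec_of_prim (O := chi A) Primrec.id
  have hfin := RecursiveIn.comp hU' (RecursiveIn.pair hid hk)
  unfold TuringLE
  refine rec_of_eq hfin fun n => ?_
  symm
  simp only [PFun.coe_val, Nat.unpair_pair, Seq.seq, Part.map_eq_map, Part.map_some,
    Part.bind_eq_bind]
  rw [Part.eq_some_iff]
  simp only [Part.mem_bind_iff, Part.mem_map_iff, Part.mem_some_iff, Part.map_some, Part.bind_some,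
    Nat.mem_rfind]
  obtain ⟨k0, hk0⟩ := (h3 (n, cb W n) ()).1 rfl
  have hex : ∃ k, T (Nat.pair n (Encodable.encode (pre (cb A) k))) = 0 := by
    refine ⟨k0, ?_⟩
    simp only [T, dl, Nat.unpair_pair, Encodable.encodek, Option.getD_some]
    rw [if_pos]
    cases hb : cb W n
    · right; rwa [hb] at hk0
    · left; rwa [hb] at hk0
  have hm := Nat.find_spec hex
  have hmin : ∀ k < Nat.find hex, _ := fun k hk => Nat.find_min hex hk
  generalize Nat.find hex = k at hm hmin
  refine Part.mem_bind_iff.2 ⟨Nat.pair n k, (Part.mem_map_iff _).2 ⟨k, ?_, rfl⟩, ?_⟩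
  · refine Nat.mem_rfind.2 ⟨?_, fun {j} hj => ?_⟩
    · simpa using hm
    · have := hmin j hj
      simpa using this
  · have hR : ∀ b, R (n, b) (pre (cb A) k) → cb W n = b := fun b hb => (h3 (n, b) ()).2 ⟨k, hb⟩
    simp only [T, dl, Nat.unpair_pair, Encodable.encodek, Option.getD_some] at hm
    have hm' : R (n, true) (pre (cb A) k) ∨ R (n, false) (pre (cb A) k) := by
      by_contra hc
      rw [if_neg hc] at hm
      exact one_ne_zero hm
    simp only [PFun.coe_val, U, dl, Nat.unpair_pair, Encodable.encodek, Option.getD_some,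
      Part.mem_some_iff]
    by_cases ht : R (n, true) (pre (cb A) k)
    · have hn : n ∈ W := cb_true.1 (hR _ ht)
      rw [if_pos ht]
      simp [chi, hn]
    · have hn : n ∉ W := by
        intro hn
        have h4 := hR _ (hm'.resolve_left ht)
        rw [cb_true.2 hn] at h4
        cases h4
      rw [if_neg ht]
      simp [chi, hn]

section basics
variable {α Ω : Type} [Primcodable α]

theorem SgO.trans_unit {B C : ℕ → Bool} {p : α → Unit → Prop} (h : SgO (fun _ : Unit => B) p)
    (hBC : Le B C) : SgO (fun _ : Unit => C) p :=
  SgO.subst h (fun _ _ => ()) (hBC.comp Primrec.snd)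

theorem Le.refl (B : ℕ → Bool) : Le B B := SgO.read Primrec.fst Primrec.snd

theorem Le.trans {A B C : ℕ → Bool} (h : Le A B) (h' : Le B C) : Le A C := SgO.trans_unit h h'

theorem primrec_two_mul {t : α → ℕ} (ht : Primrec t) : Primrec (fun a => 2 * t a) :=
  Primrec.nat_mul.comp (Primrec.const 2) ht

theorem SgO.left {B : ℕ → Bool} {p : α → Unit → Prop} (h : SgO (fun _ : Unit => B) p) :
    SgO (jn B) (fun a _ => p a ()) := by
  refine SgO.subst h (fun _ _ => ()) ?_
  refine (SgO.read (o := jn B) (primrec_two_mul (Primrec.fst.comp Primrec.snd))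
    (Primrec.snd.comp Primrec.snd)).of_iff ?_
  intro x Y
  rw [jn_even]

theorem SgO.right {B : ℕ → Bool} {t : α → ℕ} {b : α → Bool} (ht : Primrec t) (hb : Primrec b) :
    SgO (jn B) (fun a Y => Y (t a) = b a) := by
  refine (SgO.read (o := jn B) (Primrec.succ.comp (primrec_two_mul ht)) hb).of_iff ?_
  intro x Y
  rw [Nat.succ_eq_add_one, jn_odd]

theorem SgO.inst {B : ℕ → Bool} {p : α → (ℕ → Bool) → Prop} (h : SgO (jn B) p) (Y : ℕ → Bool) :
    SgO (fun _ : Unit => jn B Y) (fun a _ => p a Y) := by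
  obtain ⟨R, h1, h2, h3⟩ := h
  exact ⟨R, h1, h2, fun a _ => h3 a Y⟩

theorem Le.left (X Y : ℕ → Bool) : Le X (jn X Y) := (SgO.left (Le.refl X)).inst Y

theorem Le.right (X Y : ℕ → Bool) : Le Y (jn X Y) :=
  (SgO.right (B := X) (t := fun x : ℕ × Bool => x.1) (b := fun x : ℕ × Bool => x.2)
    Primrec.fst Primrec.snd).inst Y

theorem primrec_half {t : α → ℕ} (ht : Primrec t) : Primrec (fun a => t a / 2) :=
  Primrec.nat_div.comp ht (Primrec.const 2)

theorem Le.jn {X Y C : ℕ → Bool} (hX : Le X C) (hY : Le Y C) : Le (jn X Y) C := by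
  refine SgO.jn_iff (X := fun _ _ => X) (Y := fun _ _ => Y) Primrec.fst ?_ ?_
  · exact hX.comp (Primrec.pair (primrec_half Primrec.fst) Primrec.snd)
  · exact hY.comp (Primrec.pair (primrec_half Primrec.fst) Primrec.snd)

theorem SgO.mono_jn {B C : ℕ → Bool} {p : α → (ℕ → Bool) → Prop} (h : SgO (RRT.jn B) p)
    (hBC : Le B C) : SgO (RRT.jn C) p := by
  refine SgO.subst h (fun _ Y => Y) ?_
  refine SgO.jn_iff (X := fun _ _ => B) (Y := fun _ Y => Y) (Primrec.fst.comp Primrec.snd) ?_ ?_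
  · exact SgO.comp (SgO.left hBC) (Primrec.pair (primrec_half (Primrec.fst.comp Primrec.snd))
      (Primrec.snd.comp Primrec.snd))
  · exact SgO.right (primrec_half (Primrec.fst.comp Primrec.snd)) (Primrec.snd.comp Primrec.snd)

end basics

theorem Le.unjn {W B G : ℕ → Bool} (h : Le W (RRT.jn B G)) :
    ∃ p : ℕ × Bool → (ℕ → Bool) → Prop, SgO (RRT.jn B) p ∧ ∀ n b, W n = b ↔ p (n, b) G := by
  obtain ⟨R, h1, h2, h3⟩ := h
  refine ⟨fun x Y => ∃ k, R x (pre (RRT.jn B Y) k), ⟨R, h1, h2, fun a ω => Iff.rfl⟩, fun n b => ?_⟩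
  exact h3 (n, b) ()

theorem Le.of_sound {W B : ℕ → Bool} {r : ℕ × Bool → Unit → Prop}
    (h : SgO (fun _ : Unit => B) r) (h1 : ∀ n b, b ≠ W n → ¬ r (n, b) ()) (h2 : ∀ n, r (n, W n) ()) :
    Le W B := by
  refine h.of_iff ?_
  rintro ⟨n, b⟩ _
  constructor
  · intro (h : W n = b)
    subst h
    exact h2 n
  · intro hr
    by_contra hc
    exact h1 n b (Ne.symm hc) hr

/-- Requirements -/
def Req (B : ℕ → Bool) : Set (ℕ × Bool → (ℕ → Bool) → Prop) := {p | SgO (jn B) p}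

theorem countable_primrecRel :
    {R : ℕ × Bool → List Bool → Prop | PrimrecRel R}.Countable := by
  classical
  let D : (ℕ × Bool → List Bool → Prop) → ℕ → ℕ := fun R n =>
    Encodable.encode ((Encodable.decode (α := (ℕ × Bool) × List Bool) n).map
      (fun x => decide (R x.1 x.2)))
  have hc : Set.Countable {f : ℕ → ℕ | Computable f} := by
    have : Countable {f : ℕ → ℕ // Computable f} := inferInstance
    exact this
  have hD : Function.Injective D := by
    intro R S h
    funext a σ
    have := congrFun h (Encodable.encode (a, σ))
    simp only [D, Encodable.encodek, Option.map_some, Encodable.encode_inj] at this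
    simpa using this
  refine (hc.preimage_of_injOn (f := D) hD.injOn).mono ?_
  intro R hR
  have h1 := PrimrecRel.decide hR
  have : Nat.Primrec (D R) := h1
  exact (Primrec.nat_iff.2 this).to_comp

theorem countable_req (B : ℕ → Bool) : (Req B).Countable := by
  have : Req B ⊆ (fun R x Y => ∃ k, R x (pre (jn B Y) k)) ''
      {R : ℕ × Bool → List Bool → Prop | PrimrecRel R} := by
    rintro p ⟨R, h1, h2, h3⟩
    refine ⟨R, h1, ?_⟩
    funext x Y
    exact propext (h3 x Y).symm
  exact (countable_primrecRel.image _).mono this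

theorem req_enum (B : ℕ → Bool) : ∃ e : ℕ → (ℕ × Bool → (ℕ → Bool) → Prop),
    (∀ n, SgO (jn B) (e n)) ∧ ∀ p, SgO (jn B) p → ∃ n, e n = p := by
  have hne : (Req B).Nonempty := ⟨fun _ _ => True, (SgO.prim (PrimrecPred.of_eq
    (p := fun x : ℕ × Bool => x = x) (Primrec.eq.comp Primrec.id Primrec.id) (by simp)))⟩
  obtain ⟨e, he⟩ := (countable_req B).exists_eq_range hne
  refine ⟨e, fun n => ?_, fun p hp => ?_⟩
  · have : e n ∈ Req B := by rw [he]; exact ⟨n, rfl⟩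
    exact this
  · have : p ∈ Req B := hp
    rw [he] at this
    exact this

theorem gen_seq {C : Type} (le : C → C → Prop) (hr : ∀ c, le c c)
    (ht : ∀ a b c, le a b → le b c → le a c) (D : ℕ → C → Prop)
    (h : ∀ n p, ∃ q, le q p ∧ D n q) (p0 : C) :
    ∃ s : ℕ → C, (∀ n, le (s n) p0) ∧ (∀ m n, m ≤ n → le (s n) (s m)) ∧ ∀ n, D n (s n) := by
  choose F hF hD using h
  let s : ℕ → C := fun n => Nat.rec (F 0 p0) (fun n c => F (n + 1) c) n
  have hmono : ∀ m n, m ≤ n → le (s n) (s m) := by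
    intro m n hmn
    induction hmn with
    | refl => exact hr _
    | step _ ih => exact ht _ _ _ (hF _ _) ih
  refine ⟨s, fun n => ht _ _ _ (hmono 0 n (Nat.zero_le n)) (hF _ _), hmono, fun n => ?_⟩
  cases n with
  | zero => exact hD _ _
  | succ n => exact hD _ _

theorem SgO.isClosed {B : ℕ → Bool} {p : (ℕ → Bool) → Prop}
    (h : SgO (RRT.jn B) (fun (_ : Unit) Y => p Y)) : IsClosed {Y | ¬ p Y} := by
  rw [← isOpen_compl_iff]
  apply isOpen_of_use
  intro Y hY
  have hY' : p Y := by simpa using hY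
  obtain ⟨u, hu⟩ := SgO.use h (a := ()) hY'
  refine ⟨u, fun Y' h => ?_⟩
  have : p Y' := by
    apply hu Y'
    intro i hi
    unfold RRT.jn
    rw [h (i / 2) (by omega)]
  simpa using this

/-- cone avoiding basis theorem -/
theorem basis {W B : ℕ → Bool} (hB : ¬ Le W B) {p : (ℕ → Bool) → Prop}
    (hp : SgO (jn B) (fun (_ : Unit) Y => p Y)) (hne : ∃ Y, ¬ p Y) :
    ∃ Y, ¬ p Y ∧ ¬ Le W (jn B Y) := by
  obtain ⟨e, he, hsurj⟩ := req_enum B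
  let C := {c : (ℕ → Bool) → Prop // SgO (jn B) (fun (_ : Unit) Y => c Y) ∧ ∃ Y, ¬ c Y}
  let le : C → C → Prop := fun q p => ∀ Y, p.1 Y → q.1 Y
  let D : ℕ → C → Prop := fun n c =>
    (∃ m, ∀ Y, ¬ c.1 Y → ¬ e n (m, W m) Y) ∨ (∃ m b, b ≠ W m ∧ ∀ Y, ¬ c.1 Y → e n (m, b) Y)
  obtain ⟨s, h0, hmono, hD⟩ := gen_seq le (fun c Y h => h) (fun a b c h1 h2 Y h => h1 Y (h2 Y h)) D
    (by
      rintro n ⟨c, hc, hcne⟩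
      have hu : SgO (fun _ : Unit => B) (fun (x : ℕ × Bool) _ => ∀ Y, c Y ∨ e n x Y) := by
        apply SgO.all_cantor
        exact SgO.or (hc.comp (t := fun _ : ℕ × Bool => ()) (Primrec.const ())) (he n)
      by_cases h1 : ∃ m b, b ≠ W m ∧ ∀ Y, c Y ∨ e n (m, b) Y
      · obtain ⟨m, b, hb, h⟩ := h1
        exact ⟨⟨c, hc, hcne⟩, fun Y h => h, Or.inr ⟨m, b, hb, fun Y hY => (h Y).resolve_left hY⟩⟩
      · by_cases h2 : ∀ m, ∀ Y, c Y ∨ e n (m, W m) Y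
        · exact absurd (Le.of_sound hu (fun m b hb h => h1 ⟨m, b, hb, h⟩) h2) hB
        · push Not at h2
          obtain ⟨m, Y, hY1, hY2⟩ := h2
          refine ⟨⟨fun Y => c Y ∨ e n (m, W m) Y, ?_, ⟨Y, by tauto⟩⟩, fun Y h => Or.inl h,
            Or.inl ⟨m, fun Y h => by tauto⟩⟩
          exact hc.or ((he n).comp (t := fun _ : Unit => (m, W m)) (Primrec.const _)))
    ⟨p, hp, hne⟩
  have hne : (⋂ n, {Y | ¬ (s n).1 Y}).Nonempty := by
    apply IsCompact.nonempty_iInter_of_sequence_nonempty_isCompact_isClosed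
    · intro n Y hY h
      exact hY (hmono n (n + 1) (Nat.le_succ n) Y h)
    · exact fun n => (s n).2.2
    · exact (SgO.isClosed (s 0).2.1).isCompact
    · exact fun n => SgO.isClosed (s n).2.1
  obtain ⟨Y, hY⟩ := hne
  have hY' : ∀ n, ¬ (s n).1 Y := fun n => Set.mem_iInter.1 hY n
  refine ⟨Y, fun h => hY' 0 (h0 0 Y h), fun hle => ?_⟩
  obtain ⟨q, hq, hWq⟩ := hle.unjn
  obtain ⟨n, rfl⟩ := hsurj q hq
  rcases hD n with ⟨m, h⟩ | ⟨m, b, hb, h⟩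
  · exact h Y (hY' n) ((hWq m (W m)).1 rfl)
  · exact hb ((hWq m b).2 (h Y (hY' n))).symm

/-- finite sets as strings -/
def fin (τ : List Bool) (i : ℕ) : Bool := τ.getD i false

theorem fin_lt {τ : List Bool} {i : ℕ} (h : fin τ i = true) : i < τ.length := by
  by_contra hc
  rw [fin, List.getD_eq_default _ _ (by omega)] at h
  cases h

theorem fin_pre {Y : ℕ → Bool} {k i : ℕ} (h : i < k) : fin (pre Y k) i = Y i := pre_getD Y k i h

theorem fin_pre_le {Y : ℕ → Bool} {k i : ℕ} (h : fin (pre Y k) i = true) : Y i = true := by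
  have := fin_lt h
  rw [pre_length] at this
  rwa [fin_pre this] at h

theorem primrec_fin : Primrec₂ fin := Primrec.list_getD false

/-- infinite sets -/
def Inf (X : ℕ → Bool) : Prop := ∀ n, ∃ m, n ≤ m ∧ X m = true

/-- `F ⊆ T ⊆ F ∪ X` -/
def Ext (F : ℕ → Bool) (X : ℕ → Prop) (T : ℕ → Bool) : Prop :=
  ∀ i, (F i = true → T i = true) ∧ (T i = true → F i = true ∨ X i)

theorem Ext.trans {F T G : ℕ → Bool} {X X' : ℕ → Prop} (h : Ext F X T) (hX : ∀ i, X' i → X i)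
    (h' : Ext T X' G) : Ext F X G := by
  intro i
  have a := h i
  have b := h' i
  have c := hX i
  tauto

theorem Ext.refl (F : ℕ → Bool) (X : ℕ → Prop) : Ext F X F := fun i => ⟨id, Or.inl⟩

theorem SgO.ext {α Ω : Type} [Primcodable α] {o : Ω → ℕ → Bool} {X : α → ℕ → Ω → Prop}
    (hX : SgO o (fun (x : α × ℕ) ω => X x.1 x.2 ω)) (F : List Bool) {T : α → List Bool}
    (hT : Primrec T) :
    SgO o (fun a ω => Ext (fin F) (fun i => X a i ω) (fin (T a))) := by
  have hTi : Primrec (fun x : α × ℕ => fin (T x.1) x.2) :=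
    primrec_fin.comp (hT.comp Primrec.fst) Primrec.snd
  have hFi : Primrec (fun x : α × ℕ => fin F x.2) :=
    primrec_fin.comp (Primrec.const F) Primrec.snd
  have key : SgO o (fun a ω => ∀ i < F.length + (T a).length,
      (fin F i = false ∨ fin (T a) i = true) ∧
      (fin (T a) i = false ∨ (fin F i = true ∨ X a i ω))) := by
    apply SgO.ball (Primrec.nat_add.comp (Primrec.const _) (Primrec.list_length.comp hT))
    apply SgO.and
    · apply SgO.or
      · exact SgO.prim (Primrec.eq.comp hFi (Primrec.const _))
      · exact SgO.prim (Primrec.eq.comp hTi (Primrec.const _))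
    · apply SgO.or
      · exact SgO.prim (Primrec.eq.comp hTi (Primrec.const _))
      · apply SgO.or
        · exact SgO.prim (Primrec.eq.comp hFi (Primrec.const _))
        · exact hX
  refine key.of_iff fun a ω => ?_
  constructor
  · intro h i hi
    have := h i
    cases h1 : fin F i <;> cases h2 : fin (T a) i <;> simp_all
  · intro h i
    by_cases hi : i < F.length + (T a).length
    · have := h i hi
      cases h1 : fin F i <;> cases h2 : fin (T a) i <;> simp_all
    · constructor
      · intro h1
        have := fin_lt h1
        omega
      · intro h1
        have := fin_lt h1
        omega

theorem use_fin {α : Type} [Primcodable α] {B : ℕ → Bool} {q : α → (ℕ → Bool) → Prop}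
    (h : SgO (jn B) q) {x : α} {G : ℕ → Bool} (hq : q x G) :
    ∃ u, ∀ G', (∀ i < u, G i = G' i) → q x G' := by
  obtain ⟨u, hu⟩ := h.use hq
  refine ⟨u, fun G' h => hu G' fun i hi => ?_⟩
  unfold jn
  rw [h (i / 2) (by omega)]

/-- substituting a finite set -/
theorem SgO.fin_subst {α β : Type} [Primcodable α] [Primcodable β] {B C : ℕ → Bool}
    {q : β → (ℕ → Bool) → Prop}
    (h : SgO (jn B) q) (hBC : Le B C) {t : α → β} (ht : Primrec t) {T : α → List Bool}
    (hT : Primrec T) : SgO (jn C) (fun a _ => q (t a) (fin (T a))) := by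
  refine SgO.subst (h.comp ht) (fun a _ => fin (T a)) ?_
  refine SgO.jn_iff (X := fun _ _ => B) (Y := fun (x : α × ℕ × Bool) _ => fin (T x.1))
    (Primrec.fst.comp Primrec.snd) ?_ ?_
  · exact SgO.comp (SgO.left hBC) (Primrec.pair (primrec_half (Primrec.fst.comp Primrec.snd))
      (Primrec.snd.comp Primrec.snd))
  · exact SgO.prim (Primrec.eq.comp (primrec_fin.comp (hT.comp Primrec.fst)
      (primrec_half (Primrec.fst.comp Primrec.snd))) (Primrec.snd.comp Primrec.snd))

/-- truncation -/
def trunc (X : ℕ → Bool) (N : ℕ) (i : ℕ) : Bool := X i && decide (N ≤ i)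

theorem trunc_iff {X : ℕ → Bool} {N i : ℕ} : trunc X N i = true ↔ X i = true ∧ N ≤ i := by
  simp [trunc]

theorem trunc_le (X : ℕ → Bool) (N : ℕ) : Le (trunc X N) X := by
  have h1 : PrimrecPred (fun x : ℕ × Bool => N ≤ x.1) :=
    Primrec.nat_le.comp (Primrec.const N) Primrec.fst
  have h2 : PrimrecPred (fun x : ℕ × Bool => x.2 = false) :=
    Primrec.eq.comp Primrec.snd (Primrec.const false)
  refine (((SgO.prim h1).and (Le.refl X)).or (SgO.prim (h1.not.and h2))).of_iff ?_
  rintro ⟨n, b⟩ _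
  by_cases h : N ≤ n <;> simp [trunc, h, eq_comm]

theorem trunc_inf {X : ℕ → Bool} (h : Inf X) (N : ℕ) : Inf (trunc X N) := by
  intro n
  obtain ⟨m, hm, hX⟩ := h (max n N)
  exact ⟨m, by omega, trunc_iff.2 ⟨hX, by omega⟩⟩

/-- the functional `q` does not compute `W` from `Y` -/
def Met (W : ℕ → Bool) (q : ℕ × Bool → (ℕ → Bool) → Prop) (Y : ℕ → Bool) : Prop :=
  ¬ ∀ n b, W n = b ↔ q (n, b) Y

theorem ext_limit {F : ℕ → ℕ → Bool} {X : ℕ → ℕ → Prop}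
    (h : ∀ m n, m ≤ n → Ext (F m) (X m) (F n)) :
    ∃ G : ℕ → Bool, (∀ s, Ext (F s) (X s) G) ∧ ∀ i, G i = true → ∃ s, F s i = true := by
  classical
  refine ⟨fun i => decide (∃ s, F s i = true), fun s i => ⟨fun hi => ?_, fun hi => ?_⟩,
    fun i hi => by simpa using hi⟩
  · simpa using ⟨s, hi⟩
  · obtain ⟨t, ht⟩ : ∃ t, F t i = true := by simpa using hi
    rcases le_total s t with hst | hst
    · exact (h s t hst i).2 ht
    · exact Or.inl ((h t s hst i).1 ht)

/-- agreement with a finite string when the reservoir starts late -/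
theorem ext_agree {T : List Bool} {X : ℕ → Prop} {N : ℕ} {Y : ℕ → Bool}
    (h : Ext (fin T) X Y) (hX : ∀ i, X i → N ≤ i) : ∀ i < N, fin T i = Y i := by
  intro i hi
  have h1 := h i
  have h2 : ¬ X i := fun hx => absurd (hX i hx) (by omega)
  cases h3 : fin T i <;> cases h4 : Y i <;> simp_all

theorem ext_pre {F : List Bool} {X : ℕ → Prop} {G : ℕ → Bool} (h : Ext (fin F) X G) {k : ℕ}
    (hk : F.length ≤ k) : Ext (fin F) X (fin (pre G k)) := by
  intro i
  constructor
  · intro hi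
    have := fin_lt hi
    rw [fin_pre (by omega)]
    exact (h i).1 hi
  · intro hi
    exact (h i).2 (fin_pre_le hi)

/-- forcing conditions for the strong pigeonhole principle -/
structure Cond (W B D A : ℕ → Bool) where
  F : Bool → List Bool
  X : ℕ → Bool
  C : ℕ → Bool
  le : Le B C
  av : ¬ Le W C
  hX : Le X C
  inf : Inf X
  sub : ∀ i, X i = true → D i = true
  hF : ∀ c i, fin (F c) i = true → D i = true ∧ A i = c
  len : ∀ c i, X i = true → (F c).length ≤ i

def Cond.Ord {W B D A : ℕ → Bool} (q p : Cond W B D A) : Prop :=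
  (∀ c, Ext (fin (p.F c)) (fun i => p.X i = true) (fin (q.F c))) ∧
    ∀ i, q.X i = true → p.X i = true

theorem Cond.Ord.refl {W B D A : ℕ → Bool} (p : Cond W B D A) : p.Ord p :=
  ⟨fun c => Ext.refl _ _, fun _ h => h⟩

theorem Cond.Ord.trans {W B D A : ℕ → Bool} (r q p : Cond W B D A) (h1 : r.Ord q) (h2 : q.Ord p) :
    r.Ord p :=
  ⟨fun c => (h2.1 c).trans h2.2 (h1.1 c), fun i h => h2.2 i (h1.2 i h)⟩

/-- extending one of the finite parts inside the reservoir -/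
theorem Cond.extend {W B D A : ℕ → Bool} (p : Cond W B D A) (c : Bool) (T : List Bool)
    (hT : Ext (fin (p.F c)) (fun i => p.X i = true ∧ A i = c) (fin T)) (N : ℕ) :
    ∃ q : Cond W B D A, q.Ord p ∧ q.F c = T ∧ ∀ i, q.X i = true → N ≤ i := by
  have hT' : Ext (fin (p.F c)) (fun i => p.X i = true) (fin T) := fun i =>
    ⟨(hT i).1, fun h => ((hT i).2 h).imp id And.left⟩
  refine ⟨⟨Function.update p.F c T, trunc p.X (max N T.length), p.C, p.le, p.av,
    (trunc_le _ _).trans p.hX, trunc_inf p.inf _, fun i h => p.sub i (trunc_iff.1 h).1, ?_, ?_⟩,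
    ⟨?_, ?_⟩, ?_, ?_⟩
  · intro c' i hi
    by_cases h : c' = c
    · subst h
      simp only [Function.update_self] at hi
      rcases (hT i).2 hi with h | h
      · exact p.hF _ i h
      · exact ⟨p.sub i h.1, h.2⟩
    · rw [Function.update_of_ne h] at hi
      exact p.hF _ i hi
  · intro c' i hi
    have := trunc_iff.1 hi
    by_cases h : c' = c
    · subst h
      simp only [Function.update_self]
      have := le_max_right N T.length
      omega
    · rw [Function.update_of_ne h]
      exact p.len _ i this.1
  · intro c'
    by_cases h : c' = c
    · subst h
      simpa only [Function.update_self] using hT'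
    · simp only [Function.update_of_ne h]
      exact Ext.refl _ _
  · exact fun i h => (trunc_iff.1 h).1
  · simp
  · intro i h
    have := (trunc_iff.1 h).2
    have := le_max_left N T.length
    omega

theorem Inf.split {X : ℕ → Bool} (h : Inf X) (Y : ℕ → Bool) :
    ∃ c, Inf (fun i => X i && (Y i == c)) := by
  by_contra hc
  push Not at hc
  have h1 := hc true
  have h2 := hc false
  unfold Inf at h1 h2
  push Not at h1 h2
  obtain ⟨n1, h1⟩ := h1
  obtain ⟨n2, h2⟩ := h2
  obtain ⟨m, hm, hX⟩ := h (max n1 n2)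
  have h1 := h1 m (by omega)
  have h2 := h2 m (by omega)
  cases hY : Y m <;> simp_all

theorem Cond.force {W B D A : ℕ → Bool} (p : Cond W B D A)
    (q : Bool → ℕ × Bool → (ℕ → Bool) → Prop) (hq : ∀ c, SgO (jn B) (q c)) :
    ∃ p' : Cond W B D A, p'.Ord p ∧ ∃ c, ∀ Y, Ext (fin (p'.F c)) (fun i => p'.X i = true) Y →
      Met W (q c) Y := by
  let v : ℕ × Bool → (ℕ → Bool) → Prop := fun x Y => ∃ c, ∃ T : List Bool,
    Ext (fin (p.F c)) (fun i => p.X i = true ∧ Y i = c) (fin T) ∧ q c x (fin T)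
  have hv : SgO (jn p.C) v := by
    have hc : ∀ c, SgO (jn p.C) (fun x Y => ∃ T : List Bool,
        Ext (fin (p.F c)) (fun i => p.X i = true ∧ Y i = c) (fin T) ∧ q c x (fin T)) := by
      intro c
      apply SgO.ex
      apply SgO.and
      · refine SgO.ext (X := fun _ i (Y : ℕ → Bool) => p.X i = true ∧ Y i = c) ?_ _ Primrec.snd
        apply SgO.and
        · exact SgO.comp (SgO.left p.hX) (Primrec.pair Primrec.snd (Primrec.const true))
        · exact SgO.right Primrec.snd (Primrec.const c)
      · exact SgO.fin_subst (hq c) p.le Primrec.fst Primrec.snd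
    exact ((hc true).or (hc false)).of_iff fun x Y => by
      simp only [v]
      rw [Bool.exists_bool, or_comm]
  have hu := SgO.all_cantor hv
  by_cases h1 : ∃ m b, b ≠ W m ∧ ∀ Y, v (m, b) Y
  · obtain ⟨m, b, hb, h⟩ := h1
    obtain ⟨c, T, hT, hqT⟩ := h A
    obtain ⟨u, hu⟩ := use_fin (hq c) hqT
    obtain ⟨p', hp', hF, hX⟩ := p.extend c T hT u
    refine ⟨p', hp', c, fun Y hY hc => ?_⟩
    rw [hF] at hY
    exact hb ((hc m b).2 (hu Y (ext_agree hY hX))).symm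
  · by_cases h2 : ∀ m, ∀ Y, v (m, W m) Y
    · exact absurd (Le.of_sound hu (fun m b hb h => h1 ⟨m, b, hb, h⟩) h2) p.av
    · push Not at h2
      obtain ⟨m, Y, hY⟩ := h2
      obtain ⟨Y, hY, hav⟩ := basis p.av (hv.comp (t := fun _ : Unit => (m, W m)) (Primrec.const _))
        ⟨Y, hY⟩
      obtain ⟨c, hc⟩ := p.inf.split Y
      have hsub : ∀ i, (p.X i && (Y i == c)) = true → p.X i = true ∧ Y i = c := by
        intro i hi
        simpa using hi
      refine ⟨⟨p.F, fun i => p.X i && (Y i == c), jn p.C Y, p.le.trans (Le.left _ _), hav, ?_, hc,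
        fun i h => p.sub i (hsub i h).1, p.hF, fun c' i h => p.len c' i (hsub i h).1⟩,
        ⟨fun c => Ext.refl _ _, fun i h => (hsub i h).1⟩, c, fun G hG hcon => ?_⟩
      · have hP : Le p.X (jn p.C Y) := p.hX.trans (Le.left _ _)
        have hYl : Le Y (jn p.C Y) := Le.right _ _
        have a1 := hP.comp (t := fun x : ℕ × Bool => (x.1, true))
          (Primrec.pair Primrec.fst (Primrec.const true))
        have a2 := hP.comp (t := fun x : ℕ × Bool => (x.1, false))
          (Primrec.pair Primrec.fst (Primrec.const false))
        have b1 := hYl.comp (t := fun x : ℕ × Bool => (x.1, c))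
          (Primrec.pair Primrec.fst (Primrec.const c))
        have b2 := hYl.comp (t := fun x : ℕ × Bool => (x.1, !c))
          (Primrec.pair Primrec.fst (Primrec.const (!c)))
        have e : ∀ b : Bool, SgO (fun _ : Unit => jn p.C Y) (fun (x : ℕ × Bool) _ => x.2 = b) :=
          fun b => SgO.prim (Primrec.eq.comp Primrec.snd (Primrec.const b))
        refine (((e true).and (a1.and b1)).or ((e false).and (a2.or b2))).of_iff ?_
        rintro ⟨n, b⟩ _
        cases b <;> cases c <;> cases h1 : p.X n <;> simp [h1]
      · have hq' := (hcon m (W m)).1 rfl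
        obtain ⟨u, hu⟩ := use_fin (hq c) hq'
        apply hY
        have hG' : Ext (fin (p.F c)) (fun i => p.X i = true ∧ Y i = c) G := fun i =>
          ⟨(hG i).1, fun h => ((hG i).2 h).imp id (hsub i)⟩
        exact ⟨c, pre G (max u (p.F c).length), ext_pre hG' (le_max_right _ _),
          hu _ fun i hi => (fin_pre (by omega)).symm⟩

theorem strongRT {W B D : ℕ → Bool} (hB : ¬ Le W B) (hD : Le D B) (hinf : Inf D)
    (A : ℕ → Bool) : ∃ c H, Inf H ∧ (∀ n, H n = true → D n = true ∧ A n = c) ∧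
      ¬ Le W (jn B H) := by
  by_contra hcon
  push Not at hcon
  have hmeet : ∀ (p : Cond W B D A) c n, ∃ m, n ≤ m ∧ p.X m = true ∧ A m = c := by
    intro p c n
    by_contra hno
    push Not at hno
    have := hcon (!c) (trunc p.X n) (trunc_inf p.inf n) (by
      intro m hm
      obtain ⟨h1, h2⟩ := trunc_iff.1 hm
      have := hno m h2 h1
      refine ⟨p.sub m h1, ?_⟩
      cases h3 : A m <;> cases c <;> simp_all)
    exact p.av (this.trans (Le.jn p.le ((trunc_le _ _).trans p.hX)))
  obtain ⟨e, he, hsurj⟩ := req_enum B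
  have hinfstep : ∀ (p : Cond W B D A) c n, ∃ q : Cond W B D A, q.Ord p ∧
      ∃ i, n ≤ i ∧ fin (q.F c) i = true := by
    intro p c n
    obtain ⟨m, hm, hX, hA⟩ := hmeet p c n
    have hlen := p.len c m hX
    obtain ⟨q, hq, hF, -⟩ := p.extend c (pre (fun i => fin (p.F c) i || (i == m)) (m + 1)) (by
      intro i
      constructor
      · intro h
        have := fin_lt h
        rw [fin_pre (by omega), h]
        rfl
      · intro h
        have := fin_pre_le h
        simp only [Bool.or_eq_true, beq_iff_eq] at this
        rcases this with h | rfl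
        · exact Or.inl h
        · exact Or.inr ⟨hX, hA⟩) 0
    refine ⟨q, hq, m, hm, ?_⟩
    rw [hF, fin_pre (by omega)]
    simp
  obtain ⟨s, h0, hmono, hs⟩ := gen_seq (C := Cond W B D A) Cond.Ord Cond.Ord.refl Cond.Ord.trans
    (fun n q => (∃ c, ∀ Y, Ext (fin (q.F c)) (fun i => q.X i = true) Y →
      Met W (e (if c then n.unpair.1 else n.unpair.2)) Y) ∧
      ∀ c, ∃ i, n ≤ i ∧ fin (q.F c) i = true) (by
    intro n p
    obtain ⟨p1, h1, c, hc⟩ := p.force (fun c => e (if c then n.unpair.1 else n.unpair.2))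
      (fun c => he _)
    obtain ⟨p2, h2, i, hi, hi'⟩ := hinfstep p1 true n
    obtain ⟨p3, h3, j, hj, hj'⟩ := hinfstep p2 false n
    have h31 := Cond.Ord.trans _ _ _ h3 h2
    refine ⟨p3, Cond.Ord.trans _ _ _ h31 h1, ⟨c, fun Y hY => ?_⟩, fun c' => ?_⟩
    · exact hc Y ((h31.1 c).trans h31.2 hY)
    · cases c'
      · exact ⟨j, hj, hj'⟩
      · exact ⟨i, hi, (h3.1 true i).1 hi'⟩)
    ⟨fun _ => [], D, B, Le.refl B, hB, hD, hinf, fun _ h => h, by simp [fin], by simp⟩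
  have hG : ∀ c, ∃ G : ℕ → Bool, (∀ t, Ext (fin ((s t).F c)) (fun i => (s t).X i = true) G) ∧
      Le W (jn B G) := by
    intro c
    obtain ⟨G, hG1, hG2⟩ := ext_limit (F := fun t => fin ((s t).F c))
      (X := fun t i => (s t).X i = true) (fun m n hmn => (hmono m n hmn).1 c)
    refine ⟨G, hG1, hcon c G ?_ ?_⟩
    · intro n
      obtain ⟨i, hi, hi'⟩ := (hs n).2 c
      exact ⟨i, hi, (hG1 n i).1 hi'⟩
    · intro i hi
      obtain ⟨t, ht⟩ := hG2 i hi
      exact (s t).hF c i ht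
  choose G hG1 hG2 using hG
  have hq : ∀ c, ∃ n, ∀ m b, W m = b ↔ e n (m, b) (G c) := by
    intro c
    obtain ⟨q, hq, hWq⟩ := (hG2 c).unjn
    obtain ⟨n, rfl⟩ := hsurj q hq
    exact ⟨n, hWq⟩
  choose k hk using hq
  obtain ⟨c, hc⟩ := (hs (Nat.pair (k true) (k false))).1
  have := hc (G c) (hG1 c _)
  apply this
  rw [Nat.unpair_pair]
  cases c <;> simpa using hk _

theorem strongRT_fin {ι : Type} {W : ℕ → Bool} (S : Finset ι) (col : ℕ → ι) :
    ∀ {B D : ℕ → Bool}, ¬ Le W B → Le D B → Inf D → (∀ n, D n = true → col n ∈ S) →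
    ∃ i ∈ S, ∃ C H, Le B C ∧ ¬ Le W C ∧ Le H C ∧ Inf H ∧
      ∀ n, H n = true → D n = true ∧ col n = i := by
  classical
  induction S using Finset.induction_on with
  | empty =>
    intro B D _ _ hinf h
    obtain ⟨m, -, hm⟩ := hinf 0
    simpa using h m hm
  | insert a S ha ih =>
    intro B D hB hD hinf h
    obtain ⟨c, H, h1, h2, h3⟩ := strongRT hB hD hinf (fun n => decide (col n = a))
    cases c
    · obtain ⟨i, hi, C, H', g1, g2, g3, g4, g5⟩ := ih (B := jn B H) (D := H) h3 (Le.right _ _) h1 (by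
        intro n hn
        obtain ⟨k1, k2⟩ := h2 n hn
        have := h n k1
        have k2 : col n ≠ a := by simpa using k2
        simpa [k2] using this)
      exact ⟨i, Finset.mem_insert_of_mem hi, C, H', (Le.left _ _).trans g1, g2, g3, g4,
        fun n hn => ⟨(h2 n (g5 n hn).1).1, (g5 n hn).2⟩⟩
    · refine ⟨a, Finset.mem_insert_self _ _, jn B H, H, Le.left _ _, h3, Le.right _ _, h1, ?_⟩
      intro n hn
      exact ⟨(h2 n hn).1, by simpa using (h2 n hn).2⟩

/-- coding of quadruples -/
def pk (j s x y : ℕ) : ℕ := Nat.pair (Nat.pair j s) (Nat.pair x y)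

theorem primrec_pk {α : Type} [Primcodable α] {j s x y : α → ℕ} (hj : Primrec j) (hs : Primrec s)
    (hx : Primrec x) (hy : Primrec y) : Primrec (fun a => pk (j a) (s a) (x a) (y a)) :=
  Primrec₂.natPair.comp (Primrec₂.natPair.comp hj hs) (Primrec₂.natPair.comp hx hy)

/-- matchings coded by `P`, avoiding pairs from `F` -/
def Cls (F : ℕ → Bool) (d : ℕ) (P : ℕ → Bool) : Prop :=
  (∀ j s x y y', P (pk j s x y) = true → P (pk j s x y') = true → y = y') ∧
  ∀ j s x y, j < d → x < y → F x = true → F y = true → P (pk j s x y) = false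

/-- `T` is free for `P` -/
def Good (d : ℕ) (T P : ℕ → Bool) : Prop :=
  ∀ j x y s, j < d → x < y → T x = true → T y = true → (s = 0 ∨ (y + 1 < s ∧ T (s - 1) = true)) →
    P (pk j s x y) = false

section
variable {α : Type} [Primcodable α]

theorem sg_cls (C : ℕ → Bool) (F : List Bool) (d : ℕ) :
    SgO (jn C) (fun (_ : α) P => ¬ Cls (fin F) d P) := by
  have h1 : SgO (jn C) (fun (_ : α) P => ∃ v : (ℕ × ℕ) × (ℕ × ℕ) × ℕ, v.2.1.2 ≠ v.2.2 ∧
      (P (pk v.1.1 v.1.2 v.2.1.1 v.2.1.2) = true ∧ P (pk v.1.1 v.1.2 v.2.1.1 v.2.2) = true)) := by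
    apply SgO.ex
    have e1 : Primrec (fun x : α × ((ℕ × ℕ) × (ℕ × ℕ) × ℕ) => x.2.1.1) :=
      Primrec.fst.comp (Primrec.fst.comp Primrec.snd)
    have e2 : Primrec (fun x : α × ((ℕ × ℕ) × (ℕ × ℕ) × ℕ) => x.2.1.2) :=
      Primrec.snd.comp (Primrec.fst.comp Primrec.snd)
    have e3 : Primrec (fun x : α × ((ℕ × ℕ) × (ℕ × ℕ) × ℕ) => x.2.2.1.1) :=
      Primrec.fst.comp (Primrec.fst.comp (Primrec.snd.comp Primrec.snd))
    have e4 : Primrec (fun x : α × ((ℕ × ℕ) × (ℕ × ℕ) × ℕ) => x.2.2.1.2) :=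
      Primrec.snd.comp (Primrec.fst.comp (Primrec.snd.comp Primrec.snd))
    have e5 : Primrec (fun x : α × ((ℕ × ℕ) × (ℕ × ℕ) × ℕ) => x.2.2.2) :=
      Primrec.snd.comp (Primrec.snd.comp Primrec.snd)
    apply SgO.and
    · exact SgO.prim (PrimrecPred.not (Primrec.eq.comp e4 e5))
    apply SgO.and
    · exact SgO.right (primrec_pk e1 e2 e3 e4) (Primrec.const true)
    · exact SgO.right (primrec_pk e1 e2 e3 e5) (Primrec.const true)
  have h2 : SgO (jn C) (fun (_ : α) P => ∃ v : (ℕ × ℕ) × (ℕ × ℕ), (v.1.1 < d ∧ v.2.1 < v.2.2 ∧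
      fin F v.2.1 = true ∧ fin F v.2.2 = true) ∧ P (pk v.1.1 v.1.2 v.2.1 v.2.2) = true) := by
    apply SgO.ex
    have e1 : Primrec (fun x : α × ((ℕ × ℕ) × (ℕ × ℕ)) => x.2.1.1) :=
      Primrec.fst.comp (Primrec.fst.comp Primrec.snd)
    have e2 : Primrec (fun x : α × ((ℕ × ℕ) × (ℕ × ℕ)) => x.2.1.2) :=
      Primrec.snd.comp (Primrec.fst.comp Primrec.snd)
    have e3 : Primrec (fun x : α × ((ℕ × ℕ) × (ℕ × ℕ)) => x.2.2.1) :=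
      Primrec.fst.comp (Primrec.snd.comp Primrec.snd)
    have e4 : Primrec (fun x : α × ((ℕ × ℕ) × (ℕ × ℕ)) => x.2.2.2) :=
      Primrec.snd.comp (Primrec.snd.comp Primrec.snd)
    apply SgO.and
    · refine SgO.prim (PrimrecPred.and (Primrec.nat_lt.comp e1 (Primrec.const d))
        (PrimrecPred.and (Primrec.nat_lt.comp e3 e4) (PrimrecPred.and
          (Primrec.eq.comp (primrec_fin.comp (Primrec.const F) e3) (Primrec.const true))
          (Primrec.eq.comp (primrec_fin.comp (Primrec.const F) e4) (Primrec.const true)))))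
    · exact SgO.right (primrec_pk e1 e2 e3 e4) (Primrec.const true)
  refine (h1.or h2).of_iff fun _ P => ?_
  constructor
  · intro h
    by_contra hc
    push Not at hc
    apply h
    refine ⟨fun j s x y y' h1 h2 => ?_, fun j s x y h1 h2 h3 h4 => ?_⟩
    · by_contra hne
      exact hc.1 ((j, s), (x, y), y') hne h1 h2
    · have := hc.2 ((j, s), (x, y)) ⟨h1, h2, h3, h4⟩
      simpa using this
  · rintro (⟨v, h1, h2, h3⟩ | ⟨v, ⟨h1, h2, h3, h4⟩, h5⟩) ⟨g1, g2⟩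
    · exact h1 (g1 _ _ _ _ _ h2 h3)
    · rw [g2 _ _ _ _ h1 h2 h3 h4] at h5
      cases h5

theorem sg_good (C : ℕ → Bool) (d : ℕ) {T : α → List Bool} (hT : Primrec T) :
    SgO (jn C) (fun a P => Good d (fin (T a)) P) := by
  have key : SgO (jn C) (fun a P => ∀ j < d, ∀ s < (T a).length + 1, ∀ y < (T a).length, ∀ x < y,
      ¬ (fin (T a) x = true ∧ fin (T a) y = true ∧ (s = 0 ∨ (y + 1 < s ∧ fin (T a) (s - 1) = true)))
        ∨ P (pk j s x y) = false) := by
    apply SgO.ball (Primrec.const d)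
    apply SgO.ball (Primrec.succ.comp (Primrec.list_length.comp (hT.comp Primrec.fst)))
    apply SgO.ball (Primrec.list_length.comp (hT.comp (Primrec.fst.comp Primrec.fst)))
    apply SgO.ball Primrec.snd
    have eT : Primrec (fun z : (((α × ℕ) × ℕ) × ℕ) × ℕ => T z.1.1.1.1) :=
      hT.comp (Primrec.fst.comp (Primrec.fst.comp (Primrec.fst.comp Primrec.fst)))
    have ej : Primrec (fun z : (((α × ℕ) × ℕ) × ℕ) × ℕ => z.1.1.1.2) :=
      Primrec.snd.comp (Primrec.fst.comp (Primrec.fst.comp Primrec.fst))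
    have es : Primrec (fun z : (((α × ℕ) × ℕ) × ℕ) × ℕ => z.1.1.2) :=
      Primrec.snd.comp (Primrec.fst.comp Primrec.fst)
    have ey : Primrec (fun z : (((α × ℕ) × ℕ) × ℕ) × ℕ => z.1.2) :=
      Primrec.snd.comp Primrec.fst
    have ex : Primrec (fun z : (((α × ℕ) × ℕ) × ℕ) × ℕ => z.2) := Primrec.snd
    apply SgO.or
    · apply SgO.prim
      apply PrimrecPred.not
      refine PrimrecPred.and (Primrec.eq.comp (primrec_fin.comp eT ex) (Primrec.const true))
        (PrimrecPred.and (Primrec.eq.comp (primrec_fin.comp eT ey) (Primrec.const true))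
        (PrimrecPred.or (Primrec.eq.comp es (Primrec.const 0))
        (PrimrecPred.and (Primrec.nat_lt.comp (Primrec.succ.comp ey) es)
          (Primrec.eq.comp (primrec_fin.comp eT (Primrec.pred.comp es)) (Primrec.const true)))))
    · exact SgO.right (primrec_pk ej es ex ey) (Primrec.const false)
  refine key.of_iff fun a P => ?_
  constructor
  · intro h j hj s hs y hy x hx
    by_cases hc : fin (T a) x = true ∧ fin (T a) y = true ∧
        (s = 0 ∨ (y + 1 < s ∧ fin (T a) (s - 1) = true))
    · exact Or.inr (h j x y s hj hx hc.1 hc.2.1 hc.2.2)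
    · exact Or.inl hc
  · intro h j x y s hj hx h1 h2 h3
    have hs : s < (T a).length + 1 := by
      rcases h3 with h3 | ⟨h3, h4⟩
      · omega
      · have := fin_lt h4
        omega
    rcases h j hj s hs y (fin_lt h2) x hx with h4 | h4
    · exact absurd ⟨h1, h2, h3⟩ h4
    · exact h4

end

theorem pigeon {X : ℕ → Bool} (hX : Inf X) {N d M : ℕ} {P : ℕ → Bool}
    (hP : ∀ j s x y y', P (pk j s x y) = true → P (pk j s x y') = true → y = y') :
    ∃ y, N ≤ y ∧ X y = true ∧ ∀ j < d, ∀ x < M, P (pk j 0 x y) = false := by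
  by_contra hc
  push Not at hc
  have hfin : (⋃ j ∈ Finset.range d, ⋃ x ∈ Finset.range M,
      {y | P (pk j 0 x y) = true}).Finite := by
    apply Set.Finite.biUnion (Finset.finite_toSet _)
    intro j _
    apply Set.Finite.biUnion (Finset.finite_toSet _)
    intro x _
    apply Set.Subsingleton.finite
    intro y hy y' hy'
    exact hP _ _ _ _ _ hy hy'
  obtain ⟨K, hK⟩ := hfin.bddAbove
  obtain ⟨m, hm, hXm⟩ := hX (max N (K + 1))
  obtain ⟨j, hj, x, hx, hne⟩ := hc m (by omega) hXm
  have : m ≤ K := by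
    apply hK
    simp only [Set.mem_iUnion, Finset.mem_range]
    exact ⟨j, hj, x, hx, by simpa using hne⟩
  omega

theorem exists_rec (Φ : (y : ℕ) → ((x : ℕ) → x < y → Bool) → Bool) :
    ∃ g : ℕ → Bool, ∀ y, g y = Φ y (fun x _ => g x) := by
  have hwf : WellFounded ((· < ·) : ℕ → ℕ → Prop) := wellFounded_lt
  exact ⟨hwf.fix Φ, fun y => hwf.fix_eq Φ y⟩

/-- greedy thinning -/
theorem greedy {W C X : ℕ → Bool} (hC : ¬ Le W C) (hX : Le X C) (hinf : Inf X) (F : List Bool)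
    (d : ℕ) {P : ℕ → Bool} (hPC : Le P C)
    (hP : ∀ j s x y y', P (pk j s x y) = true → P (pk j s x y') = true → y = y') :
    ∃ X', Inf X' ∧ ¬ Le W (jn C X') ∧ ∀ y, X' y = true → X y = true ∧
      ∀ x < y, (fin F x = true ∨ X' x = true) → ∀ j < d, P (pk j 0 x y) = false := by
  classical
  let bad : (ℕ → Bool) → Prop := fun Y => ∃ y,
    (Y y = true ∧ (X y = false ∨ ∃ x < y, (fin F x = true ∨ Y x = true) ∧
      ∃ j < d, P (pk j 0 x y) = true)) ∨
    ((Y y = false ∧ X y = true) ∧ ∀ x < y, (fin F x = false ∧ Y x = false) ∨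
      ∀ j < d, P (pk j 0 x y) = false)
  have hbad : SgO (jn C) (fun (_ : Unit) Y => bad Y) := by
    apply SgO.ex
    apply SgO.or
    · apply SgO.and
      · exact SgO.right Primrec.snd (Primrec.const true)
      apply SgO.or
      · exact SgO.comp (SgO.left hX) (Primrec.pair Primrec.snd (Primrec.const false))
      apply SgO.bex Primrec.snd
      apply SgO.and
      · apply SgO.or
        · exact SgO.prim (Primrec.eq.comp (primrec_fin.comp (Primrec.const F) Primrec.snd)
            (Primrec.const true))
        · exact SgO.right Primrec.snd (Primrec.const true)
      · apply SgO.bex (Primrec.const d)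
        exact SgO.comp (SgO.left hPC) (Primrec.pair (primrec_pk Primrec.snd (Primrec.const 0)
          (Primrec.snd.comp Primrec.fst) (Primrec.snd.comp (Primrec.fst.comp Primrec.fst)))
          (Primrec.const true))
    · apply SgO.and
      · apply SgO.and
        · exact SgO.right Primrec.snd (Primrec.const false)
        · exact SgO.comp (SgO.left hX) (Primrec.pair Primrec.snd (Primrec.const true))
      apply SgO.ball Primrec.snd
      apply SgO.or
      · apply SgO.and
        · exact SgO.prim (Primrec.eq.comp (primrec_fin.comp (Primrec.const F) Primrec.snd)
            (Primrec.const false))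
        · exact SgO.right Primrec.snd (Primrec.const false)
      · apply SgO.ball (Primrec.const d)
        exact SgO.comp (SgO.left hPC) (Primrec.pair (primrec_pk Primrec.snd (Primrec.const 0)
          (Primrec.snd.comp Primrec.fst) (Primrec.snd.comp (Primrec.fst.comp Primrec.fst)))
          (Primrec.const false))
  have hne : ∃ Y, ¬ bad Y := by
    obtain ⟨g, hg⟩ := exists_rec (fun y g => decide (X y = true ∧ ∀ x (h : x < y),
      (fin F x = true ∨ g x h = true) → ∀ j < d, P (pk j 0 x y) = false))
    refine ⟨g, ?_⟩
    rintro ⟨y, h | h⟩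
    · obtain ⟨h1, h2⟩ := h
      rw [hg] at h1
      obtain ⟨h3, h4⟩ := of_decide_eq_true h1
      rcases h2 with h2 | ⟨x, hx, h5, j, hj, h6⟩
      · rw [h2] at h3
        cases h3
      · rw [h4 x hx h5 j hj] at h6
        cases h6
    · obtain ⟨⟨h1, h2⟩, h3⟩ := h
      rw [hg] at h1
      apply of_decide_eq_false h1
      refine ⟨h2, fun x hx h4 j hj => ?_⟩
      rcases h3 x hx with h5 | h5
      · simp [h5.1, h5.2] at h4
      · exact h5 j hj
  obtain ⟨Y, hY, hav⟩ := basis hC hbad hne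
  simp only [bad] at hY
  push Not at hY
  refine ⟨Y, ?_, hav, fun y hy => ?_⟩
  · by_contra hni
    unfold Inf at hni
    push Not at hni
    obtain ⟨N, hN⟩ := hni
    obtain ⟨y, hy1, hy2, hy3⟩ := pigeon hinf (N := N) (d := d) (M := max N F.length) hP
    have h1 : Y y = false := by simpa using hN y hy1
    obtain ⟨x, hx, h2, j, hj, h3⟩ := (hY y).2 ⟨h1, hy2⟩
    have hxM : x < max N F.length := by
      by_contra hxM
      have h4 : fin F x = false := by
        by_contra h5
        have := fin_lt (by simpa using h5 : fin F x = true)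
        omega
      have h5 : Y x = false := by
        have := hN x (by omega)
        simpa using this
      exact h2 h4 h5
    exact h3 (hy3 j hj x hxM)
  · obtain ⟨h1, h2⟩ := (hY y).1 hy
    refine ⟨by simpa using h1, fun x hx h3 j hj => ?_⟩
    have := h2 x hx h3 j hj
    simpa using this

/-- freeness of a set for finitely many families of matchings -/
def FreeFor (d : ℕ) (f : ℕ → ℕ → ℕ → ℕ → Prop) (T : ℕ → Bool) : Prop :=
  ∀ j x y z, j < d → x < y → y < z → T x = true → T y = true → T z = true → ¬ f j z x y

/-- main forcing conditions -/
structure MC (W Z : ℕ → Bool) where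
  F : List Bool
  X : ℕ → Bool
  C : ℕ → Bool
  d : ℕ
  f : ℕ → ℕ → ℕ → ℕ → Prop
  le : Le Z C
  av : ¬ Le W C
  hX : Le X C
  inf : Inf X
  len : ∀ i, X i = true → F.length ≤ i
  mat : ∀ j z x y y', f j z x y → f j z x y' → y = y'
  free : ∀ j x y z, j < d → x < y → y < z → fin F x = true → fin F y = true →
    (fin F z = true ∨ X z = true) → ¬ f j z x y

def MC.Ord {W Z : ℕ → Bool} (q p : MC W Z) : Prop :=
  Ext (fin p.F) (fun i => p.X i = true) (fin q.F) ∧ (∀ i, q.X i = true → p.X i = true) ∧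
    ∀ T, FreeFor q.d q.f T → FreeFor p.d p.f T

theorem MC.Ord.refl {W Z : ℕ → Bool} (p : MC W Z) : p.Ord p :=
  ⟨Ext.refl _ _, fun _ h => h, fun _ h => h⟩

theorem MC.Ord.trans {W Z : ℕ → Bool} (r q p : MC W Z) (h1 : r.Ord q) (h2 : q.Ord p) : r.Ord p :=
  ⟨h2.1.trans h2.2.1 h1.1, fun i h => h2.2.1 i (h1.2.1 i h), fun T h => h2.2.2 T (h1.2.2 T h)⟩

/-- positive case: some finite extension works for almost all points of the reservoir -/
theorem MC.positive {W Z : ℕ → Bool} (p : MC W Z) (Ev : List Bool → Prop) (N : List Bool → ℕ)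
    (h : ∀ P, Cls (fin p.F) p.d P → ∃ T : List Bool,
      Ext (fin p.F) (fun i => p.X i = true) (fin T) ∧ Good p.d (fin T) P ∧ Ev T) :
    ∃ q : MC W Z, q.Ord p ∧ Ev q.F ∧ ∀ i, q.X i = true → N q.F ≤ i := by
  classical
  let K : Set (ℕ → Bool) := {P | ¬ ¬ Cls (fin p.F) p.d P}
  have hK : IsCompact K := (SgO.isClosed (sg_cls (α := Unit) p.C p.F p.d)).isCompact
  let I := {T : List Bool // Ext (fin p.F) (fun i => p.X i = true) (fin T) ∧ Ev T}
  let U : I → Set (ℕ → Bool) := fun T => {P | Good p.d (fin T.1) P}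
  have hU : ∀ T, IsOpen (U T) := by
    intro T
    apply isOpen_of_use
    intro P hP
    exact use_fin (sg_good p.C p.d (T := fun T : List Bool => T) Primrec.id) (x := T.1) hP
  have hcov : K ⊆ ⋃ T, U T := by
    intro P hP
    obtain ⟨T, h1, h2, h3⟩ := h P (not_not.1 hP)
    exact Set.mem_iUnion.2 ⟨⟨T, h1, h3⟩, h2⟩
  obtain ⟨t, ht⟩ := hK.elim_finite_subcover U hU hcov
  let Q : ℕ → ℕ → ℕ → ℕ → ℕ → Prop := fun x j s a b =>
    if s = 0 then p.f j x a b ∧ a < b ∧ b < x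
    else p.f j (s - 1) a b ∧ (a < b ∧ b < s - 1) ∧ (fin p.F (s - 1) = true ∨ p.X (s - 1) = true)
  let P : ℕ → ℕ → Bool := fun x n =>
    decide (Q x n.unpair.1.unpair.1 n.unpair.1.unpair.2 n.unpair.2.unpair.1 n.unpair.2.unpair.2)
  have hP : ∀ x j s a b, P x (pk j s a b) = true ↔ Q x j s a b := by
    intro x j s a b
    simp [P, pk]
  have hPC : ∀ x, p.X x = true → Cls (fin p.F) p.d (P x) := by
    intro x hx
    refine ⟨fun j s a b b' h1 h2 => ?_, fun j s a b hj hab ha hb => ?_⟩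
    · rw [hP] at h1 h2
      by_cases hs : s = 0
      · simp only [Q, hs, if_true] at h1 h2
        exact p.mat _ _ _ _ _ h1.1 h2.1
      · simp only [Q, hs, if_false] at h1 h2
        exact p.mat _ _ _ _ _ h1.1 h2.1
    · by_contra hc
      have hc : Q x j s a b := (hP _ _ _ _ _).1 (by simpa using hc)
      by_cases hs : s = 0
      · simp only [Q, hs, if_true] at hc
        exact p.free j a b x hj hab hc.2.2 ha hb (Or.inr hx) hc.1
      · simp only [Q, hs, if_false] at hc
        exact p.free j a b _ hj hab hc.2.1.2 ha hb hc.2.2 hc.1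
  have hcol : ∀ x, ∃ T : Option I, p.X x = true → ∃ T' ∈ t, T = some T' ∧ P x ∈ U T' := by
    intro x
    by_cases hx : p.X x = true
    · obtain ⟨T, hT⟩ := Set.mem_iUnion.1 (ht (not_not.2 (hPC x hx)))
      obtain ⟨hT, hT'⟩ := Set.mem_iUnion.1 hT
      exact ⟨some T, fun _ => ⟨T, hT, rfl, hT'⟩⟩
    · exact ⟨none, fun h => absurd h hx⟩
  choose col hcol using hcol
  obtain ⟨i, hi, C, H, hBC, hav, hHC, hHinf, hH⟩ := strongRT_fin (W := W) (t.image some) col p.av p.hX p.inf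
    (by
      intro n hn
      obtain ⟨T, hT, h1, -⟩ := hcol n hn
      rw [h1]
      exact Finset.mem_image_of_mem _ hT)
  obtain ⟨T, hT, rfl⟩ := Finset.mem_image.1 hi
  have hgood : ∀ n, H n = true → Good p.d (fin T.1) (P n) := by
    intro n hn
    obtain ⟨h1, h2⟩ := hH n hn
    obtain ⟨T', -, h3, h4⟩ := hcol n h1
    rw [h2] at h3
    cases h3
    exact h4
  obtain ⟨hTe, hTev⟩ := T.2
  refine ⟨⟨T.1, trunc H (max (N T.1) T.1.length), C, p.d, p.f, p.le.trans hBC, hav,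
    (trunc_le _ _).trans hHC, trunc_inf hHinf _, ?_, p.mat, ?_⟩, ⟨hTe, ?_, fun _ h => h⟩, hTev, ?_⟩
  · intro i hi
    have := (trunc_iff.1 hi).2
    omega
  · intro j a b z hj hab hbz ha hb hz hf
    rcases hz with hz | hz
    · obtain ⟨n, -, hn⟩ := hHinf 0
      have := hgood n hn j a b (z + 1) hj hab ha hb (Or.inr ⟨by omega, by simpa using hz⟩)
      have hq : Q n j (z + 1) a b := by
        simp only [Q]
        rw [if_neg (by omega)]
        exact ⟨hf, ⟨hab, hbz⟩, (hTe z).2 hz⟩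
      rw [(hP _ _ _ _ _).2 hq] at this
      cases this
    · have hz := trunc_iff.1 hz
      have := hgood z hz.1 j a b 0 hj hab ha hb (Or.inl rfl)
      have hq : Q z j 0 a b := by
        simp only [Q]
        rw [if_pos trivial]
        exact ⟨hf, hab, hbz⟩
      rw [(hP _ _ _ _ _).2 hq] at this
      cases this
  · intro i hi
    exact (hH i (trunc_iff.1 hi).1).1
  · intro i hi
    have := (trunc_iff.1 hi).2
    have := le_max_left (N T.1) T.1.length
    show N T.1 ≤ i
    omega

theorem MC.infinite {W Z : ℕ → Bool} (p : MC W Z) (n : ℕ) :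
    ∃ q : MC W Z, q.Ord p ∧ ∃ i, n ≤ i ∧ fin q.F i = true := by
  obtain ⟨q, h1, h2, -⟩ := p.positive (fun T => ∃ i, n ≤ i ∧ fin T i = true) (fun _ => 0) (by
    intro P hP
    obtain ⟨a, ha1, ha2, ha3⟩ := pigeon p.inf (N := n) (d := p.d) (M := p.F.length) hP.1
    have hlen := p.len a ha2
    have hT : ∀ i, fin (pre (fun i => fin p.F i || (i == a)) (a + 1)) i = true ↔
        fin p.F i = true ∨ i = a := by
      intro i
      constructor
      · intro h
        have := fin_pre_le h
        simpa using this
      · intro h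
        have : i < a + 1 := by
          rcases h with h | h
          · have := fin_lt h
            omega
          · omega
        rw [fin_pre this]
        simpa using h
    refine ⟨pre (fun i => fin p.F i || (i == a)) (a + 1), fun i => ⟨fun h => (hT i).2 (Or.inl h),
      fun h => ?_⟩, ?_, a, ha1, (hT a).2 (Or.inr rfl)⟩
    · rcases (hT i).1 h with h | rfl
      · exact Or.inl h
      · exact Or.inr ha2
    · intro j x y s hj hxy hx hy hs
      rw [hT] at hx hy
      rw [hT] at hs
      have l1 : fin p.F x = true → x < p.F.length := fin_lt
      have l2 : fin p.F y = true → y < p.F.length := fin_lt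
      have l3 : fin p.F (s - 1) = true → s - 1 < p.F.length := fin_lt
      rcases hy with hy | rfl
      · rcases hx with hx | rfl
        · exact hP.2 j s x y hj hxy hx hy
        · have := l2 hy
          omega
      · rcases hx with hx | rfl
        · have hs0 : s = 0 := by
            rcases hs with hs | ⟨hs, h | h⟩
            · exact hs
            · have := l3 h
              omega
            · omega
          subst hs0
          exact ha3 j hj x (l1 hx)
        · omega)
  exact ⟨q, h1, h2⟩

theorem MC.force {W Z : ℕ → Bool} (p : MC W Z) (q : ℕ × Bool → (ℕ → Bool) → Prop)
    (hq : SgO (jn Z) q) :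
    ∃ p' : MC W Z, p'.Ord p ∧ ∀ Y, Ext (fin p'.F) (fun i => p'.X i = true) Y →
      FreeFor p'.d p'.f Y → Met W q Y := by
  let v : ℕ × Bool → (ℕ → Bool) → Prop := fun x P => ¬ Cls (fin p.F) p.d P ∨
    ∃ T : List Bool, Ext (fin p.F) (fun i => p.X i = true) (fin T) ∧ Good p.d (fin T) P ∧
      q x (fin T)
  have hv : SgO (jn p.C) v := by
    apply SgO.or (sg_cls _ _ _)
    apply SgO.ex
    apply SgO.and
    · refine SgO.ext (X := fun _ i _ => p.X i = true) ?_ _ Primrec.snd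
      exact SgO.comp (SgO.left p.hX) (Primrec.pair Primrec.snd (Primrec.const true))
    apply SgO.and
    · exact sg_good _ _ Primrec.snd
    · exact SgO.fin_subst hq p.le Primrec.fst Primrec.snd
  have hu := SgO.all_cantor hv
  by_cases h1 : ∃ m b, b ≠ W m ∧ ∀ P, v (m, b) P
  · obtain ⟨m, b, hb, h⟩ := h1
    have huse : ∀ T : List Bool, ∃ u, q (m, b) (fin T) → ∀ G', (∀ i < u, fin T i = G' i) →
        q (m, b) G' := by
      intro T
      by_cases hT : q (m, b) (fin T)
      · obtain ⟨u, hu⟩ := use_fin hq hT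
        exact ⟨u, fun _ => hu⟩
      · exact ⟨0, fun h => absurd h hT⟩
    choose u hu using huse
    obtain ⟨p', hp', hE, hN⟩ := p.positive (fun T => q (m, b) (fin T)) u (by
      intro P hP
      exact (h P).resolve_left (not_not.2 hP))
    refine ⟨p', hp', fun Y hY _ hc => ?_⟩
    exact hb ((hc m b).2 (hu _ hE Y (ext_agree hY hN))).symm
  · by_cases h2 : ∀ m, ∀ P, v (m, W m) P
    · exact absurd (Le.of_sound hu (fun m b hb h => h1 ⟨m, b, hb, h⟩) h2) p.av
    · push Not at h2
      obtain ⟨m, P, hP⟩ := h2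
      obtain ⟨P, hP, hav⟩ := basis p.av (hv.comp (t := fun _ : Unit => (m, W m)) (Primrec.const _))
        ⟨P, hP⟩
      simp only [v, not_or, not_not, not_exists, not_and] at hP
      obtain ⟨hcls, hno⟩ := hP
      obtain ⟨X', hX1, hX2, hX3⟩ := greedy hav (p.hX.trans (Le.left _ P)) p.inf p.F p.d
        (Le.right _ P) hcls.1
      refine ⟨⟨p.F, X', jn (jn p.C P) X', 2 * p.d,
        fun j z x y => if j < p.d then p.f j z x y else P (pk (j - p.d) (z + 1) x y) = true,
        (p.le.trans (Le.left _ P)).trans (Le.left _ _), hX2, Le.right _ _, hX1,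
        fun i h => p.len i (hX3 i h).1, ?_, ?_⟩, ⟨Ext.refl _ _, fun i h => (hX3 i h).1, ?_⟩, ?_⟩
      · intro j z x y y' h1 h2
        by_cases hj : j < p.d
        · rw [if_pos hj] at h1 h2
          exact p.mat _ _ _ _ _ h1 h2
        · rw [if_neg hj] at h1 h2
          exact hcls.1 _ _ _ _ _ h1 h2
      · intro j x y z hj hxy hyz hx hy hz
        by_cases hj' : j < p.d
        · rw [if_pos hj']
          exact p.free j x y z hj' hxy hyz hx hy (hz.imp id fun h => (hX3 z h).1)
        · rw [if_neg hj', hcls.2 _ _ _ _ (by omega) hxy hx hy]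
          simp
      · intro T hT j x y z hj hxy hyz hx hy hz
        have := hT j x y z (by show j < 2 * p.d; omega) hxy hyz hx hy hz
        simpa only [if_pos hj] using this
      · intro G hG hfree hcon
        have hG : Ext (fin p.F) (fun i => X' i = true) G := hG
        have hq' := (hcon m (W m)).1 rfl
        obtain ⟨u, hu⟩ := use_fin hq hq'
        have hG' : Ext (fin p.F) (fun i => p.X i = true) G := fun i =>
          ⟨(hG i).1, fun h => ((hG i).2 h).imp id fun h => (hX3 i h).1⟩
        refine hno (pre G (max u p.F.length)) (ext_pre hG' (le_max_right _ _)) ?_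
          (hu _ fun i hi => (fin_pre (by omega)).symm)
        intro j x y s hj hxy hx hy hs
        have hx := fin_pre_le hx
        have hy := fin_pre_le hy
        rcases hs with rfl | ⟨hs, hs'⟩
        · rcases (hG y).2 hy with hy | hy
          · rcases (hG x).2 hx with hx | hx
            · exact hcls.2 _ _ _ _ hj hxy hx hy
            · have := p.len x (hX3 x hx).1
              have := fin_lt hy
              omega
          · exact (hX3 y hy).2 x hxy ((hG x).2 hx) j hj
        · have hs' := fin_pre_le hs'
          have := hfree (p.d + j) x y (s - 1) (by show p.d + j < 2 * p.d; omega) hxy (by omega)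
            hx hy hs'
          have e1 : ¬ p.d + j < p.d := by omega
          have e2 : p.d + j - p.d = j := by omega
          have e3 : s - 1 + 1 = s := by omega
          simp only [if_neg e1, e2, e3] at this
          simpa using this

theorem main_forcing {W Z : ℕ → Bool} (hWZ : ¬ Le W Z) (f : ℕ → ℕ → ℕ → Prop)
    (hf : ∀ z x y y', f z x y → f z x y' → y = y') :
    ∃ G : ℕ → Bool, Inf G ∧ (∀ x y z, x < y → y < z → G x = true → G y = true → G z = true →
      ¬ f z x y) ∧ ¬ Le W (jn Z G) := by
  obtain ⟨e, he, hsurj⟩ := req_enum Z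
  let p0 : MC W Z := ⟨[], fun _ => true, Z, 1, fun _ => f, Le.refl Z, hWZ,
    SgO.prim (Primrec.eq.comp (Primrec.const true) Primrec.snd), fun n => ⟨n, le_rfl, rfl⟩,
    by simp, fun _ => hf, by simp [fin]⟩
  obtain ⟨s, h0, hmono, hs⟩ := gen_seq (C := MC W Z) MC.Ord MC.Ord.refl MC.Ord.trans
    (fun n q => (∀ Y, Ext (fin q.F) (fun i => q.X i = true) Y → FreeFor q.d q.f Y →
      Met W (e n) Y) ∧ ∃ i, n ≤ i ∧ fin q.F i = true) (by
    intro n p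
    obtain ⟨p1, h1, hm⟩ := p.force (e n) (he n)
    obtain ⟨p2, h2, hi⟩ := p1.infinite n
    exact ⟨p2, MC.Ord.trans _ _ _ h2 h1, fun Y hY hfr =>
      hm Y (h2.1.trans h2.2.1 hY) (h2.2.2 Y hfr), hi⟩) p0
  obtain ⟨G, hG1, hG2⟩ := ext_limit (F := fun t => fin (s t).F)
    (X := fun t i => (s t).X i = true) (fun m n hmn => (hmono m n hmn).1)
  have hmem : ∀ i, G i = true → ∃ t, ∀ t' ≥ t, fin (s t').F i = true := by
    intro i hi
    obtain ⟨t, ht⟩ := hG2 i hi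
    exact ⟨t, fun t' h => ((hmono t t' h).1 i).1 ht⟩
  have hself : ∀ t, FreeFor (s t).d (s t).f (fin (s t).F) := by
    intro t j x y z hj hxy hyz hx hy hz
    exact (s t).free j x y z hj hxy hyz hx hy (Or.inl hz)
  have hfree : ∀ t, FreeFor (s t).d (s t).f G := by
    intro t j x y z hj hxy hyz hx hy hz
    obtain ⟨t1, h1⟩ := hmem x hx
    obtain ⟨t2, h2⟩ := hmem y hy
    obtain ⟨t3, h3⟩ := hmem z hz
    let t4 := max t (max t1 (max t2 t3))
    have := (hmono t t4 (le_max_left _ _)).2.2 _ (hself t4)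
    exact this j x y z hj hxy hyz (h1 t4 (by simp [t4])) (h2 t4 (by simp [t4]))
      (h3 t4 (by simp [t4]))
  refine ⟨G, fun n => ?_, ?_, fun hle => ?_⟩
  · obtain ⟨i, hi, hi'⟩ := (hs n).2
    exact ⟨i, hi, (hG1 n i).1 hi'⟩
  · intro x y z hxy hyz hx hy hz
    exact (h0 0).2.2 G (hfree 0) 0 x y z Nat.one_pos hxy hyz hx hy hz
  · obtain ⟨q, hq, hWq⟩ := hle.unjn
    obtain ⟨n, rfl⟩ := hsurj q hq
    exact (hs n).1 G (hG1 n) (hfree n) hWq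

theorem le_of_turingLE {W A : Set ℕ} (h : TuringLE W A) : Le (cb W) (cb A) := by
  have h1 := sg_of_recursiveIn h
  have h2 : SgO (fun _ : Unit => cb A) (fun (x : ℕ × Bool) _ => (if x.2 = true then 1 else 0) ∈
      (chi W : ℕ →. ℕ) x.1) :=
    h1.comp (Primrec.pair Primrec.fst (Primrec.ite (Primrec.eq.comp Primrec.snd
      (Primrec.const true)) (Primrec.const 1) (Primrec.const 0)))
  refine h2.of_iff ?_
  rintro ⟨n, b⟩ _
  by_cases hn : n ∈ W <;> cases b <;> simp [cb, chi, hn]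

theorem cb_join_le (G Z : Set ℕ) : Le (cb (join G Z)) (jn (cb Z) (cb G)) := by
  have h : cb (join G Z) = jn (cb G) (cb Z) := by
    funext n
    have hiff : cb (join G Z) n = true ↔ jn (cb G) (cb Z) n = true := by
      rw [cb_true]
      unfold join jn
      simp only [Set.mem_setOf_eq]
      split_ifs with h
      · rw [cb_true]
        constructor
        · rintro (⟨m, hm, rfl⟩ | ⟨m, hm, rfl⟩)
          · have : 2 * m / 2 = m := by omega
            rwa [this]
          · omega
        · intro hm
          exact Or.inl ⟨_, hm, by omega⟩
      · rw [cb_true]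
        constructor
        · rintro (⟨m, hm, rfl⟩ | ⟨m, hm, rfl⟩)
          · omega
          · have : (2 * m + 1) / 2 = m := by omega
            rwa [this]
        · intro hm
          exact Or.inr ⟨_, hm, by omega⟩
    exact Bool.eq_iff_iff.2 hiff
  rw [h]
  exact Le.jn (Le.right _ _) (Le.left _ _)

/-- if `W ≰_T Z` and `f` is a 2-bounded coloring of `[ℕ]²` such that ℕ itself
is a tail `f`-rainbow (no computability hypothesis on `f`), then there is an infinite
`f`-rainbow `G` with `W ≰_T G ⊕ Z`. -/
theorem statement5 (W Z : Set ℕ) (hWZ : ¬ TuringLE W Z) (f : ℕ → ℕ → ℕ)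
    (hbounded : Bounded2Pairs f) (htail : TailRainbowOn f Set.univ) :
    ∃ G : Set ℕ, G.Infinite ∧ RainbowOn f G ∧ ¬ TuringLE W (join G Z) := by
  have hav : ¬ Le (cb W) (cb Z) := fun h => hWZ (recursiveIn_of_Le h)
  obtain ⟨G, hG1, hG2, hG3⟩ := main_forcing hav (fun z x y => x < y ∧ y < z ∧ f x z = f y z) (by
    rintro z x y y' ⟨h1, h2, h3⟩ ⟨h4, h5, h6⟩
    by_contra hne
    have hb := hbounded (f x z)
    have hsub : ({(x, z), (y, z), (y', z)} : Set (ℕ × ℕ)) ⊆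
        {p : ℕ × ℕ | p.1 < p.2 ∧ f p.1 p.2 = f x z} := by
      intro p hp
      simp only [Set.mem_insert_iff, Set.mem_singleton_iff] at hp
      rcases hp with rfl | rfl | rfl
      · exact ⟨by simp; omega, rfl⟩
      · exact ⟨h2, h3.symm⟩
      · exact ⟨h5, h6.symm⟩
    have h3c : ({(x, z), (y, z), (y', z)} : Set (ℕ × ℕ)).encard = 3 := by
      apply Set.encard_eq_three.2
      refine ⟨_, _, _, ?_, ?_, ?_, rfl⟩
      · simp; omega
      · simp; omega
      · simpa using hne
    have := (Set.encard_le_encard hsub).trans hb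
    rw [h3c] at this
    exact absurd this (by decide))
  have hmem : ∀ i, i ∈ {n | G n = true} ↔ G i = true := fun i => Iff.rfl
  have hcb : cb {n | G n = true} = G := by
    funext i
    exact Bool.eq_iff_iff.2 (cb_true.trans (hmem i))
  refine ⟨{n | G n = true}, ?_, ?_, ?_⟩
  · rw [Set.infinite_iff_exists_gt]
    intro n
    obtain ⟨m, hm, hGm⟩ := hG1 (n + 1)
    exact ⟨m, hGm, by omega⟩
  · intro x₀ x₁ y₀ y₁ hx₀ hx₁ hy₀ hy₁ hx hy hfe
    have h1 : x₁ = y₁ := by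
      by_contra hne
      exact htail x₀ x₁ y₀ y₁ trivial trivial trivial trivial hx hy hne hfe
    subst h1
    refine ⟨?_, rfl⟩
    rcases lt_trichotomy x₀ y₀ with h | h | h
    · exact absurd ⟨h, hy, hfe⟩ (hG2 x₀ y₀ x₁ h hy hx₀ hy₀ hx₁)
    · exact h
    · exact absurd ⟨h, hx, hfe.symm⟩ (hG2 y₀ x₀ x₁ h hx hy₀ hx₀ hx₁)
  · intro hle
    apply hG3
    have := (le_of_turingLE hle).trans (cb_join_le _ _)
    rwa [hcb] at this

end RRT
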